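/- Let k > n+2 be even and c a standard-form cusp. Then for every z ∈ H_S, (1/2)·Σ_{g ∈ L₁+c, Q₁(g)=0, gcd(S₁g)=1, γ(g)≠0} j(g,z)^{−k} = Σ_{λ ∈ L₀^# ∩ P_S} a_c(λ)·e^{2πi(λ,z)₀}, where γ(g) is the last coordinate of g and a_c(λ) := (c_{k,S}^•/2)·Q₀(λ)^{k−(n+2)/2}·Σ_{0≠γ∈ℤ} γ^{−k}·Σ_g exp(2πi(λ,d)₀/γ), the inner sum running over all g = (δ, dᵀ, γ)ᵀ ∈ L₁ − c with Q₁(g) = 0 and gcd(S₁g) = 1, where d runs over a fixed set of representatives of the middle components modulo γ·ℤ^{n+2} (the inner sum is independent of the choice of representatives); all series converge absolutely. -/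

import Mathlib

open Matrix Complex

namespace OEis

/-- Extension of an even Gram matrix by a hyperbolic plane:
`[[0,0,1],[0,A,0],[1,0,0]]`. -/
def hyp {m : ℕ} (A : Matrix (Fin m) (Fin m) ℤ) :
    Matrix (Fin (m + 2)) (Fin (m + 2)) ℤ := fun i j =>
  if hi0 : (i : ℕ) = 0 then (if (j : ℕ) = m + 1 then 1 else 0)
  else if him : (i : ℕ) = m + 1 then (if (j : ℕ) = 0 then 1 else 0)
  else if hj0 : (j : ℕ) = 0 then 0
  else if hjm : (j : ℕ) = m + 1 then 0
  else A ⟨(i : ℕ) - 1, by have := i.isLt; omega⟩ ⟨(j : ℕ) - 1, by have := j.isLt; omega⟩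

variable (n : ℕ) (S : Matrix (Fin n) (Fin n) ℤ)

/-- `S₀ = [[0,0,1],[0,-S,0],[1,0,0]]`. -/
def MatS0 : Matrix (Fin (n + 2)) (Fin (n + 2)) ℤ := hyp (-S)

/-- `S₁ = [[0,0,1],[0,S₀,0],[1,0,0]]`. -/
def MatS1 : Matrix (Fin (n + 4)) (Fin (n + 4)) ℤ := hyp (MatS0 n S)

/-- Bilinear form `uᵀ A v` over a field `K`. -/
def bilin {m : ℕ} (K : Type) [Field K] (A : Matrix (Fin m) (Fin m) ℤ)
    (u v : Fin m → K) : K :=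
  u ⬝ᵥ (A.map (Int.cast : ℤ → K)).mulVec v

/-- Quadratic form `Q_A(v) = vᵀAv/2` over a field `K`. -/
def quadF {m : ℕ} (K : Type) [Field K] (A : Matrix (Fin m) (Fin m) ℤ)
    (v : Fin m → K) : K := bilin K A v v / 2

/-- First component of a vector. -/
def vfirst {m : ℕ} {K : Type} (g : Fin (m + 2) → K) : K := g ⟨0, by omega⟩

/-- Last component of a vector. -/
def vlast {m : ℕ} {K : Type} (g : Fin (m + 2) → K) : K := g ⟨m + 1, by omega⟩

/-- Middle components of a vector. -/
def vmid {m : ℕ} {K : Type} (g : Fin (m + 2) → K) : Fin m → K :=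
  fun i => g ⟨(i : ℕ) + 1, by have := i.isLt; omega⟩

/-- gcd of the entries of a rational vector (via numerators). -/
def ratGcd {m : ℕ} (v : Fin m → ℚ) : ℕ :=
  Finset.gcd Finset.univ fun i => (v i).num.natAbs

/-- `v` has integral entries. -/
def inLat {m : ℕ} (v : Fin m → ℚ) : Prop := ∀ i, ∃ z : ℤ, v i = (z : ℚ)

/-- `g ∈ ℤ^m + c`. -/
def inLatShift {m : ℕ} (c g : Fin m → ℚ) : Prop := ∀ i, ∃ z : ℤ, g i - c i = (z : ℚ)

/-- Membership in the dual lattice `A⁻¹ℤ^m`, i.e. `Av` is integral. -/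
def inDual {m : ℕ} (A : Matrix (Fin m) (Fin m) ℤ) (v : Fin m → ℚ) : Prop :=
  ∀ i, ∃ z : ℤ, ((A.map (Int.cast : ℤ → ℚ)).mulVec v) i = (z : ℚ)

/-- The positive cone `P_S`. -/
def PosCone : Set (Fin (n + 2) → ℝ) :=
  {y | 0 < quadF ℝ (MatS0 n S) y ∧ 0 < y ⟨0, by omega⟩}

/-- The tube domain `H_S`. -/
def HS : Set (Fin (n + 2) → ℂ) :=
  {z | (fun i => (z i).im) ∈ PosCone n S}

/-- Automorphy factor attached to a vector:
`j(g,z) = -γ Q₀(z) + (d,z)₀ + δ` for `g = (δ,dᵀ,γ)ᵀ`. -/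
noncomputable def jay (g : Fin (n + 4) → ℚ) (z : Fin (n + 2) → ℂ) : ℂ :=
  -((vlast g : ℚ) : ℂ) * quadF ℂ (MatS0 n S) z
    + bilin ℂ (MatS0 n S) (fun i => ((vmid g i : ℚ) : ℂ)) z
    + ((vfirst g : ℚ) : ℂ)

/-- The index set of the Eisenstein series attached to a cusp `c`:
`{g ∈ L₁ + c : Q₁(g) = 0, gcd(S₁g) = 1}`. -/
def cuspSet (c : Fin (n + 4) → ℚ) : Set (Fin (n + 4) → ℚ) :=
  {g | inLatShift c g ∧ quadF ℚ (MatS1 n S) g = 0 ∧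
    ratGcd (((MatS1 n S).map (Int.cast : ℤ → ℚ)).mulVec g) = 1}

/-- The standard-form cusp vector `(1, 0, 𝔠ᵀ, 0, Q(𝔠))ᵀ`. -/
def stdCuspVec (fc : Fin n → ℚ) : Fin (n + 4) → ℚ := fun i =>
  if h0 : (i : ℕ) = 0 then 1
  else if h3 : (i : ℕ) = n + 3 then quadF ℚ S fc
  else if h12 : (i : ℕ) = 1 ∨ (i : ℕ) = n + 2 then 0
  else fc ⟨(i : ℕ) - 2, by have := i.isLt; omega⟩

/-- `c` is a standard-form cusp. -/
def IsStdCusp (c : Fin (n + 4) → ℚ) : Prop :=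
  ∃ fc : Fin n → ℚ, inDual S fc ∧ (∃ z : ℤ, quadF ℚ S fc = (z : ℚ)) ∧
    c = stdCuspVec n S fc

/-- The real orthogonal group of `A`. -/
def OSet {m : ℕ} (A : Matrix (Fin m) (Fin m) ℤ) : Set (Matrix (Fin m) (Fin m) ℝ) :=
  {M | Mᵀ * A.map (Int.cast : ℤ → ℝ) * M = A.map (Int.cast : ℤ → ℝ)}

/-- Connected component of the identity in the real orthogonal group. -/
def OPlus {m : ℕ} (A : Matrix (Fin m) (Fin m) ℤ) : Set (Matrix (Fin m) (Fin m) ℝ) :=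
  connectedComponentIn (OSet A) 1

/-- `Γ_S`: integral matrices in `O⁺(S₁;ℝ)`. -/
def GammaS : Set (Matrix (Fin (n + 4)) (Fin (n + 4)) ℝ) :=
  {M | M ∈ OPlus (MatS1 n S) ∧ ∀ i j, ∃ z : ℤ, M i j = (z : ℝ)}

/-- The discriminant kernel `Γ̃_S`. -/
def GammaTilde : Set (Matrix (Fin (n + 4)) (Fin (n + 4)) ℝ) :=
  {M | M ∈ GammaS n S ∧
    ∃ X : Matrix (Fin (n + 4)) (Fin (n + 4)) ℤ,
      M = 1 + (X * MatS1 n S).map (Int.cast : ℤ → ℝ)}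

/-- Automorphy factor of a matrix: `j(M,z) = -γ Q₀(z) + (d,z)₀ + δ`
where `(γ, dᵀS₀, δ)` is the bottom row of `M`. -/
noncomputable def jayM (M : Matrix (Fin (n + 4)) (Fin (n + 4)) ℝ)
    (z : Fin (n + 2) → ℂ) : ℂ :=
  -((M ⟨n + 3, by omega⟩ ⟨0, by omega⟩ : ℝ) : ℂ) * quadF ℂ (MatS0 n S) z
    + ∑ i : Fin (n + 2),
        ((M ⟨n + 3, by omega⟩ ⟨(i : ℕ) + 1, by have := i.isLt; omega⟩ : ℝ) : ℂ) * z i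
    + ((M ⟨n + 3, by omega⟩ ⟨n + 3, by omega⟩ : ℝ) : ℂ)

/-- The action `M⟨z⟩ = (-Q₀(z)·b + Kz + c')·j(M,z)⁻¹`. -/
noncomputable def actM (M : Matrix (Fin (n + 4)) (Fin (n + 4)) ℝ)
    (z : Fin (n + 2) → ℂ) : Fin (n + 2) → ℂ := fun i =>
  (-(quadF ℂ (MatS0 n S) z) *
      ((M ⟨(i : ℕ) + 1, by have := i.isLt; omega⟩ ⟨0, by omega⟩ : ℝ) : ℂ)
    + ∑ j : Fin (n + 2),
        ((M ⟨(i : ℕ) + 1, by have := i.isLt; omega⟩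
            ⟨(j : ℕ) + 1, by have := j.isLt; omega⟩ : ℝ) : ℂ) * z j
    + ((M ⟨(i : ℕ) + 1, by have := i.isLt; omega⟩ ⟨n + 3, by omega⟩ : ℝ) : ℂ))
  * (jayM n S M z)⁻¹

/-- The integral vector `(−Q₀(d)/γ, dᵀ, γ)ᵀ` built from `d` and `γ`. -/
def gExt (d : Fin (n + 2) → ℕ) (γ : ℕ) : Fin (n + 4) → ℚ := fun i =>
  if h0 : (i : ℕ) = 0 then -(quadF ℚ (MatS0 n S) fun j => (d j : ℚ)) / γ
  else if h3 : (i : ℕ) = n + 3 then (γ : ℚ)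
  else (d ⟨(i : ℕ) - 1, by have := i.isLt; omega⟩ : ℚ)

open scoped Classical in
/-- The Dirichlet coefficient `a(λ,γ)`. -/
noncomputable def aCoef (lam : Fin (n + 2) → ℚ) (γ : ℕ) : ℂ :=
  ∑ d ∈ Fintype.piFinset fun _ : Fin (n + 2) => Finset.range γ,
    if (∃ e : ℤ, quadF ℚ (MatS0 n S) (fun j => (d j : ℚ)) = (γ : ℚ) * e) ∧
        ratGcd (((MatS1 n S).map (Int.cast : ℤ → ℚ)).mulVec (gExt n S d γ)) = 1 then
      Complex.exp (2 * Real.pi * Complex.I *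
        ((bilin ℚ (MatS0 n S) lam (fun j => (d j : ℚ)) / γ : ℚ) : ℂ))
    else 0

/-- The convolution `b(λ,γ) = Σ_{δ∣γ} a(λ,δ)`. -/
noncomputable def bCoef (lam : Fin (n + 2) → ℚ) (γ : ℕ) : ℂ :=
  ∑ δ ∈ γ.divisors, aCoef n S lam δ

/-- The order/level of a rational vector: least `N ≥ 1` with `Nv` integral. -/
noncomputable def ordv {m : ℕ} (v : Fin m → ℚ) : ℕ :=
  sInf {N : ℕ | 0 < N ∧ ∀ i, ∃ z : ℤ, (N : ℚ) * v i = (z : ℚ)}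

/-- `S` is `p`-maximal. -/
def pMaximal (p : ℕ) : Prop :=
  ∀ v : Fin n → ℚ, inDual S v → (∃ z : ℤ, quadF ℚ S v = (z : ℚ)) → ¬ p ∣ ordv v

/-- The vector `(l, μᵀ, m)ᵀ ∈ ℚ^{n+2}`. -/
def asmVec (l : ℚ) (μ : Fin n → ℚ) (m : ℚ) : Fin (n + 2) → ℚ := fun i =>
  if h0 : (i : ℕ) = 0 then l
  else if h1 : (i : ℕ) = n + 1 then m
  else μ ⟨(i : ℕ) - 1, by have := i.isLt; omega⟩

open scoped Classical in
/-- The representation number `N(λ, p^ν, p^t)`. -/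
noncomputable def Ncount (lam : Fin (n + 2) → ℚ) (p νl ν t : ℕ) : ℕ :=
  ((Fintype.piFinset fun _ : Fin n => Finset.range (p ^ ν)).filter fun v =>
    (∃ e : ℤ, quadF ℚ S (fun i => (v i : ℚ)) = (p : ℚ) ^ (t : ℕ) * e) ∧
    (∃ e : ℤ, (p : ℚ) ^ ((νl : ℤ) - (t : ℤ)) * quadF ℚ S (fun i => (v i : ℚ))
        - bilin ℚ S (fun i => (v i : ℚ)) (vmid lam)
        + (p : ℚ) ^ ((t : ℤ) - (νl : ℤ)) * lam ⟨0, by omega⟩ * lam ⟨n + 1, by omega⟩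
      = (p : ℚ) ^ (ν : ℕ) * e)).card

/-- `N*(λ,p^ν) = Σ_{t=0}^{min(ν,ν_λ)} N(λ,p^ν,p^t)`. -/
noncomputable def Nstar (lam : Fin (n + 2) → ℚ) (p νl ν : ℕ) : ℕ :=
  ∑ t ∈ Finset.range (min ν νl + 1), Ncount n S lam p νl ν t

/-- Kloosterman sum `K(α,β;γ)` (with `β` allowed rational;
in all uses `β` is an integer). -/
noncomputable def kloos (α : ℤ) (β : ℚ) (γ : ℕ) : ℂ :=
  ∑ j ∈ Finset.range γ,
    if Nat.Coprime j γ then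
      Complex.exp (2 * Real.pi * Complex.I *
        ((((α : ℚ) * j + β * ((((j : ZMod γ)⁻¹).val : ℕ) : ℚ)) / γ : ℚ) : ℂ))
    else 0

/-- `q ≡ 0 (mod p^k)` in `ℤ_p`, for a rational `q`. -/
def pCong (p k : ℕ) (q : ℚ) : Prop :=
  q = 0 ∨ (k : ℤ) ≤ padicValRat p q

/-- The constant `c_{k,S}^• = (2π)^{2k-n/2}/(√(det S)·Γ(k)·Γ(k-n/2))`. -/
noncomputable def ckS (k : ℕ) : ℝ :=
  (2 * Real.pi) ^ ((2 * k : ℝ) - n / 2) /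
    (Real.sqrt ((S.det : ℤ) : ℝ) * Real.Gamma (k : ℝ) * Real.Gamma ((k : ℝ) - n / 2))

end OEis

open OEis

/-- The set of `g = (δ,dᵀ,γ)ᵀ ∈ L₁ − c` with `Q₁(g) = 0`, `gcd(S₁g) = 1`,
last coordinate `γ` and the middle component `d` reduced to the fixed set of
representatives modulo `γ·ℤ^{n+2}` determined by `0 ≤ d + c̃ < |γ|`
componentwise. -/
def Gset (n : ℕ) (S : Matrix (Fin n) (Fin n) ℤ) (c : Fin (n + 4) → ℚ)
    (γ : ℤ) : Set (Fin (n + 4) → ℚ) :=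
  {g | inLatShift (fun i => -(c i)) g ∧ quadF ℚ (MatS1 n S) g = 0 ∧
    ratGcd (((MatS1 n S).map (Int.cast : ℤ → ℚ)).mulVec g) = 1 ∧
    vlast g = (γ : ℚ) ∧
    ∀ i, 0 ≤ vmid g i + vmid c i ∧ vmid g i + vmid c i < |(γ : ℚ)|}

/-- The Fourier coefficient `a_c(λ)` of the cusp term of `E_{k,S,c}`. -/
noncomputable def aFC (n : ℕ) (S : Matrix (Fin n) (Fin n) ℤ) (k : ℕ)
    (c : Fin (n + 4) → ℚ) (lam : Fin (n + 2) → ℚ) : ℂ :=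
  ((ckS n S k : ℝ) : ℂ) / 2 *
    ((((quadF ℚ (MatS0 n S) lam : ℚ) : ℝ) ^ ((k : ℝ) - (n + 2) / 2) : ℝ) : ℂ) *
    ∑' γ : {γ : ℤ // γ ≠ 0}, ((γ.1 : ℂ)) ^ (-(k : ℤ)) *
      ∑' g : Gset n S c γ.1,
        Complex.exp (2 * Real.pi * Complex.I *
          ((bilin ℚ (MatS0 n S) lam (vmid g.1) / (γ.1 : ℚ) : ℚ) : ℂ))

section Poisson

open MeasureTheory

/-- The inverse powers `(1 + ‖m‖) ^ (-r)` are summable over `ℤ^ι` once `r > |ι|`. -/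
theorem summable_inv_one_add_norm_pow {ι : Type*} [Fintype ι] {r : ℕ} (hr : Fintype.card ι < r) :
    Summable fun m : ι → ℤ => ((1 + ‖fun i => (m i : ℝ)‖) ^ r)⁻¹ := by
  classical
  let b := Pi.basisFun ℝ ι
  let L := Submodule.span ℤ (Set.range b)
  let e : (ι → ℤ) ≃ₗ[ℤ] L := (b.restrictScalars ℤ).equivFun.symm
  have hfin : Module.finrank ℤ L = Fintype.card ι :=
    Module.finrank_eq_card_basis (b.restrictScalars ℤ)
  have he : ∀ m : ι → ℤ, ((e m : L) : ι → ℝ) = fun i => (m i : ℝ) := by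
    intro m
    simp only [e, Module.Basis.equivFun_symm_apply, Submodule.coe_sum, Submodule.coe_smul]
    ext i
    simp [b, Module.Basis.restrictScalars_apply, Pi.single_apply]
  have h1 := ((ZLattice.summable_norm_pow_inv L r (by rw [hfin]; exact hr)).comp_injective
    e.injective)
  refine Summable.of_norm_bounded_eventually h1 ?_
  refine (Set.finite_singleton (0 : ι → ℤ)).subset fun m hm => ?_
  by_contra hne
  apply hm
  have hpos : 0 < ‖fun i => (m i : ℝ)‖ := by
    rw [norm_pos_iff]
    intro h
    apply hne
    ext i
    simpa using congrFun h i
  have : ‖e m‖ = ‖fun i => (m i : ℝ)‖ := by rw [← he]; rfl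
  simp only [Set.mem_ofPred_eq, Function.comp_apply, this]
  rw [Real.norm_of_nonneg (by positivity), inv_pow]
  gcongr
  linarith

theorem inv_one_add_norm_pow_add_le {E : Type*} [SeminormedAddCommGroup E] {R : ℝ} {x : E}
    (hx : ‖x‖ ≤ R) (y : E) (r : ℕ) :
    ((1 + ‖x + y‖) ^ r)⁻¹ ≤ (1 + R) ^ r * ((1 + ‖y‖) ^ r)⁻¹ := by
  have hR : 0 ≤ R := (norm_nonneg x).trans hx
  have h1 : ‖y‖ ≤ ‖x + y‖ + ‖x‖ := by
    simpa [add_comm] using norm_sub_le (x + y) x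
  have h2 : 1 + ‖y‖ ≤ (1 + R) * (1 + ‖x + y‖) := by nlinarith [norm_nonneg (x + y)]
  rw [← div_eq_mul_inv, inv_le_comm₀ (by positivity) (by positivity), inv_div,
    div_le_iff₀ (by positivity), mul_comm, ← mul_pow]
  gcongr

/-- The half-open unit cube with corner `m`. -/
theorem iUnion_unitCube {ι : Type*} :
    (⋃ m : ι → ℤ, {x : ι → ℝ | ∀ i, x i + m i ∈ Set.Ioc (0 : ℝ) (0 + 1)}) = Set.univ := by
  rw [Set.eq_univ_iff_forall]
  intro x
  choose m hm _ using fun i => existsUnique_add_zsmul_mem_Ioc (zero_lt_one (α := ℝ)) (x i) 0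
  refine Set.mem_iUnion.2 ⟨m, fun i => ?_⟩
  simpa using hm i

theorem pairwise_disjoint_unitCube {ι : Type*} :
    Pairwise (Function.onFun Disjoint fun m : ι → ℤ =>
      {x : ι → ℝ | ∀ i, x i + m i ∈ Set.Ioc (0 : ℝ) (0 + 1)}) := by
  intro m m' hne
  refine Set.disjoint_left.2 fun x hx hx' => hne ?_
  ext i
  refine (existsUnique_add_zsmul_mem_Ioc (zero_lt_one (α := ℝ)) (x i) 0).unique ?_ ?_
  · simpa using hx i
  · simpa using hx' i

theorem measurableSet_unitCube {ι : Type*} [Fintype ι] (m : ι → ℝ) :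
    MeasurableSet {x : ι → ℝ | ∀ i, x i + m i ∈ Set.Ioc (0 : ℝ) (0 + 1)} := by
  have : {x : ι → ℝ | ∀ i, x i + m i ∈ Set.Ioc (0 : ℝ) (0 + 1)}
      = ⋂ i, (fun x : ι → ℝ => x i + m i) ⁻¹' Set.Ioc (0 : ℝ) (0 + 1) := by
    ext; simp
  rw [this]
  exact MeasurableSet.iInter fun i => measurableSet_Ioc.preimage (by fun_prop)

theorem hasSum_setIntegral_unitCube {ι : Type*} [Fintype ι] {f : (ι → ℝ) → ℂ}
    (hf : Integrable f) :
    HasSum (fun m : ι → ℤ => ∫ x in {x : ι → ℝ | ∀ i, x i ∈ Set.Ioc (0 : ℝ) (0 + 1)},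
      f (x + fun i => (m i : ℝ))) (∫ x, f x) := by
  have h := hasSum_integral_iUnion (μ := volume) (f := f)
    (s := fun m : ι → ℤ => {x : ι → ℝ | ∀ i, x i + m i ∈ Set.Ioc (0 : ℝ) (0 + 1)})
    (fun m => measurableSet_unitCube _) pairwise_disjoint_unitCube hf.integrableOn
  rw [iUnion_unitCube, setIntegral_univ] at h
  have key : ∀ m : ι → ℤ,
      ∫ x in {x : ι → ℝ | ∀ i, x i + ((-m) i : ℤ) ∈ Set.Ioc (0 : ℝ) (0 + 1)}, f x
      = ∫ x in {x : ι → ℝ | ∀ i, x i ∈ Set.Ioc (0 : ℝ) (0 + 1)}, f (x + fun i => (m i : ℝ)) := by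
    intro m
    rw [← (measurePreserving_add_right volume (fun i => (m i : ℝ))).setIntegral_preimage_emb
      (measurableEmbedding_addRight _)]
    congr 2
    ext x
    simp
  have h2 := (Equiv.neg (ι → ℤ)).hasSum_iff.2 h
  refine h2.congr_fun ?_
  intro m
  exact (key m).symm

theorem UnitAddTorus.mFourier_coe_apply {ι : Type*} [Fintype ι] (m : ι → ℤ) (x : ι → ℝ) :
    UnitAddTorus.mFourier m (fun i => (x i : UnitAddCircle))
      = Complex.exp (2 * Real.pi * Complex.I * ∑ i, (m i : ℂ) * x i) := by
  simp only [UnitAddTorus.mFourier, ContinuousMap.coe_mk, fourier_coe_apply, ← Complex.exp_sum]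
  congr 1
  rw [Finset.mul_sum]
  exact Finset.sum_congr rfl fun i _ => by push_cast; ring

/-- **Poisson summation** on `ℝ^ι` for continuous functions of polynomial decay with summable
Fourier transform. -/
theorem tsum_eq_tsum_integral_of_decay {ι : Type*} [Fintype ι] {F : (ι → ℝ) → ℂ}
    (hF : Continuous F) {C : ℝ} {r : ℕ} (hr : Fintype.card ι < r)
    (hb : ∀ x, ‖F x‖ ≤ C * ((1 + ‖x‖) ^ r)⁻¹)
    (hs : Summable fun m : ι → ℤ =>
      ∫ x : ι → ℝ, Complex.exp (2 * Real.pi * Complex.I * ∑ i, (m i : ℂ) * x i) * F x) :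
    ∑' m : ι → ℤ, F (fun i => (m i : ℝ)) = ∑' m : ι → ℤ,
      ∫ x : ι → ℝ, Complex.exp (2 * Real.pi * Complex.I * ∑ i, (m i : ℂ) * x i) * F x := by
  have hC : 0 ≤ C := by
    have := (norm_nonneg _).trans (hb 0)
    simpa using this
  have hbR : ∀ R : ℝ, ∀ m : ι → ℤ, ∀ x : ι → ℝ, ‖x‖ ≤ R →
      ‖F (x + fun i => (m i : ℝ))‖ ≤
        C * ((1 + R) ^ r * ((1 + ‖fun i => (m i : ℝ)‖) ^ r)⁻¹) := fun R m x hx =>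
    (hb _).trans (mul_le_mul_of_nonneg_left (inv_one_add_norm_pow_add_le hx _ r) hC)
  have hsumR : ∀ R : ℝ, Summable fun m : ι → ℤ =>
      C * ((1 + R) ^ r * ((1 + ‖fun i => (m i : ℝ)‖) ^ r)⁻¹) := fun R =>
    ((summable_inv_one_add_norm_pow hr).mul_left _).mul_left _
  set P : (ι → ℝ) → ℂ := fun x => ∑' m : ι → ℤ, F (x + fun i => (m i : ℝ)) with hP
  have hPc : Continuous P := by
    rw [continuous_iff_continuousAt]
    intro x
    refine ContinuousOn.continuousAt (s := Metric.closedBall 0 (‖x‖ + 1)) ?_ ?_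
    · exact continuousOn_tsum (fun m => by fun_prop) (hsumR (‖x‖ + 1))
        fun m y hy => hbR _ m y (by simpa using hy)
    · exact Metric.closedBall_mem_nhds_of_mem (by simp)
  have hPper : ∀ x (m : ι → ℤ), P (x + fun i => (m i : ℝ)) = P x := by
    intro x m
    simp only [hP]
    rw [← (Equiv.addLeft m).tsum_eq (fun m' : ι → ℤ => F (x + fun i => (m' i : ℝ)))]
    refine tsum_congr fun m' => ?_
    congr 1
    ext i
    simp [add_assoc]
  let π : (ι → ℝ) → UnitAddTorus ι := Pi.map fun _ => QuotientAddGroup.mk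
  have hπ : IsOpenQuotientMap π :=
    IsOpenQuotientMap.piMap fun _ => QuotientAddGroup.isOpenQuotientMap_mk
  have hfac : ∀ x y, π x = π y → P x = P y := by
    intro x y hxy
    have : ∀ i, ∃ m : ℤ, (m : ℝ) = -x i + y i := by
      intro i
      have hi := congrFun hxy i
      simp only [π, Pi.map_apply] at hi
      rw [QuotientAddGroup.eq, AddSubgroup.mem_zmultiples_iff] at hi
      obtain ⟨m, hm⟩ := hi
      exact ⟨m, by simpa using hm⟩
    choose m hm using this
    rw [← hPper x m]
    congr 1
    ext i
    simp [hm]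
  let g : UnitAddTorus ι → ℂ := fun t => P (Function.surjInv hπ.surjective t)
  have hgπ : g ∘ π = P := by
    ext x
    exact hfac _ _ (Function.surjInv_eq hπ.surjective (π x))
  let G : C(UnitAddTorus ι, ℂ) := ⟨g, hπ.isQuotientMap.continuous_iff.2 (hgπ ▸ hPc)⟩
  have hFint : Integrable F := by
    have h1 : Integrable (fun x : ι → ℝ => C * (1 + ‖x‖) ^ (-(r : ℝ))) :=
      (integrable_one_add_norm (by simpa using hr)).const_mul C
    refine h1.mono' hF.aestronglyMeasurable (Filter.Eventually.of_forall fun x => ?_)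
    refine (hb x).trans_eq ?_
    rw [Real.rpow_neg (by positivity), Real.rpow_natCast]
  have hnorm : ∀ (m : ι → ℤ) (x : ι → ℝ),
      ‖Complex.exp (2 * Real.pi * Complex.I * ∑ i, (m i : ℂ) * x i)‖ = 1 := by
    intro m x
    rw [show (2 * Real.pi * Complex.I * ∑ i, (m i : ℂ) * x i : ℂ)
      = ((2 * Real.pi * ∑ i, (m i : ℝ) * x i : ℝ) : ℂ) * Complex.I by push_cast; ring]
    exact Complex.norm_exp_ofReal_mul_I _
  have hcoef : ∀ m : ι → ℤ, UnitAddTorus.mFourierCoeff G m =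
      ∫ x : ι → ℝ, Complex.exp (2 * Real.pi * Complex.I * ∑ i, ((-m) i : ℂ) * x i) * F x := by
    intro m
    rw [UnitAddTorus.mFourierCoeff_eq_integral _ _ 0]
    set f : (ι → ℝ) → ℂ := fun x =>
      Complex.exp (2 * Real.pi * Complex.I * ∑ i, ((-m) i : ℂ) * x i) * F x with hf
    have hfc : Continuous f := by fun_prop
    have hnf : ∀ x, ‖f x‖ = ‖F x‖ := fun x => by
      simp only [hf, norm_mul]
      rw [hnorm (-m) x, one_mul]
    have hfi : Integrable f := hFint.norm.mono' hfc.aestronglyMeasurable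
      (Filter.Eventually.of_forall fun x => (hnf x).le)
    have h1 := hasSum_setIntegral_unitCube hfi
    have hQ : ∀ x ∈ {x : ι → ℝ | ∀ i, x i ∈ Set.Ioc (0 : ℝ) (0 + 1)}, ‖x‖ ≤ 1 := by
      intro x hx
      rw [pi_norm_le_iff_of_nonneg zero_le_one]
      intro i
      have := hx i
      rw [Real.norm_eq_abs, abs_le]
      exact ⟨by linarith [this.1], by linarith [this.2]⟩
    have hQm : MeasurableSet {x : ι → ℝ | ∀ i, x i ∈ Set.Ioc (0 : ℝ) (0 + 1)} := by
      simpa using measurableSet_unitCube (0 : ι → ℝ)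
    have hQv : volume {x : ι → ℝ | ∀ i, x i ∈ Set.Ioc (0 : ℝ) (0 + 1)} < ⊤ :=
      (measure_mono (fun x hx => by simpa using hQ x hx)).trans_lt
        (measure_closedBall_lt_top (x := (0 : ι → ℝ)) (r := 1))
    have h2 := hasSum_integral_of_summable_integral_norm
      (μ := volume.restrict {x : ι → ℝ | ∀ i, x i ∈ Set.Ioc (0 : ℝ) (0 + 1)})
      (F := fun (m' : ι → ℤ) x => f (x + fun i => (m' i : ℝ)))
      (fun m' => (hfi.comp_add_right _).integrableOn) (by
        refine Summable.of_nonneg_of_le (fun m' => integral_nonneg fun _ => norm_nonneg _)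
          (fun m' => ?_) ((hsumR 1).mul_left
            (volume.real {x : ι → ℝ | ∀ i, x i ∈ Set.Ioc (0 : ℝ) (0 + 1)}))
        refine (setIntegral_mono_on (hfi.comp_add_right _).norm.integrableOn
          (integrableOn_const hQv.ne) hQm (fun x hx => ?_)).trans_eq
          (setIntegral_const (C * ((1 + 1) ^ r * ((1 + ‖fun i => (m' i : ℝ)‖) ^ r)⁻¹)))
        rw [hnf]
        exact hbR 1 m' x (hQ x hx))
    simp only [Pi.zero_apply]
    rw [h1.unique h2]
    refine integral_congr_ae (Filter.Eventually.of_forall fun x => ?_)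
    have hG : G (fun i => (x i : UnitAddCircle)) = P x := congrFun hgπ x
    beta_reduce
    rw [hG, UnitAddTorus.mFourier_coe_apply, hP, smul_eq_mul, ← tsum_mul_left]
    refine tsum_congr fun m' => ?_
    simp only [hf]
    congr 1
    rw [Complex.exp_eq_exp_iff_exists_int]
    refine ⟨∑ i, m i * m' i, ?_⟩
    push_cast
    simp only [Pi.add_apply, Pi.neg_apply, Int.cast_neg, Complex.ofReal_add, Complex.ofReal_intCast,
      Finset.mul_sum, mul_add, Finset.sum_add_distrib]
    rw [Finset.sum_mul, add_assoc, left_eq_add, ← Finset.sum_add_distrib]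
    refine Finset.sum_eq_zero fun i _ => ?_
    ring
  have hsc : Summable (UnitAddTorus.mFourierCoeff G) := by
    refine ((Equiv.neg (ι → ℤ)).summable_iff.2 hs).congr fun m => ?_
    rw [hcoef]
    simp
  have hfin := (UnitAddTorus.hasSum_mFourier_series_apply_of_summable hsc 0).tsum_eq
  have hG0 : G 0 = P 0 := congrFun hgπ 0
  rw [hG0] at hfin
  have hP0 : P 0 = ∑' m : ι → ℤ, F (fun i => (m i : ℝ)) := by simp [hP]
  rw [← hP0, ← hfin, ← (Equiv.neg (ι → ℤ)).tsum_eq]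
  refine tsum_congr fun m => ?_
  rw [hcoef]
  have : UnitAddTorus.mFourier ((Equiv.neg (ι → ℤ)) m) (0 : UnitAddTorus ι) = 1 := by
    simp [UnitAddTorus.mFourier]
  rw [this]
  simp

end Poisson

section GammaIntegral

open MeasureTheory Set

theorem integrableOn_rpow_mul_exp_neg_mul_Ioi {s b : ℝ} (hs : -1 < s) (hb : 0 < b) :
    IntegrableOn (fun t : ℝ => t ^ s * Real.exp (-b * t)) (Ioi 0) := by
  simpa using integrableOn_rpow_mul_exp_neg_mul_rpow hs zero_lt_one hb

theorem norm_cpow_mul_cexp_neg {s t : ℝ} (ht : 0 < t) (r : ℂ) :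
    ‖(t : ℂ) ^ (s : ℂ) * Complex.exp (-(r * t))‖ = t ^ s * Real.exp (-r.re * t) := by
  rw [norm_mul, Complex.norm_cpow_eq_rpow_re_of_pos ht, Complex.norm_exp]
  simp

theorem continuousOn_cpow_mul_cexp_neg (s r : ℂ) :
    ContinuousOn (fun t : ℝ => (t : ℂ) ^ s * Complex.exp (-(r * t))) (Ioi 0) := by
  refine ContinuousOn.mul (fun t ht => ?_) (by fun_prop)
  exact ((Complex.continuousAt_ofReal_cpow_const t s (Or.inr ht.ne'))).continuousWithinAt

theorem integrableOn_cpow_mul_cexp_neg {s : ℝ} (hs : -1 < s) {r : ℂ} (hr : 0 < r.re) :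
    IntegrableOn (fun t : ℝ => (t : ℂ) ^ (s : ℂ) * Complex.exp (-(r * t))) (Ioi 0) := by
  refine (integrableOn_rpow_mul_exp_neg_mul_Ioi hs hr).mono'
    ((continuousOn_cpow_mul_cexp_neg _ _).aestronglyMeasurable measurableSet_Ioi) ?_
  filter_upwards [ae_restrict_mem measurableSet_Ioi] with t ht
  exact (norm_cpow_mul_cexp_neg ht r).le

theorem differentiableOn_integral_cpow_mul_cexp_neg {a : ℝ} (ha : 0 < a) :
    DifferentiableOn ℂ (fun r : ℂ => ∫ t in Ioi (0 : ℝ),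
      (t : ℂ) ^ ((a - 1 : ℝ) : ℂ) * Complex.exp (-(r * t))) {r | 0 < r.re} := by
  intro r hr
  have hr : 0 < r.re := hr
  have hball : ∀ q ∈ Metric.ball r (r.re / 2), r.re / 2 < q.re := by
    intro q hq
    have h1 : |q.re - r.re| < r.re / 2 :=
      (Complex.abs_re_le_norm (q - r)).trans_lt (by simpa [dist_eq_norm] using hq)
    linarith [(abs_lt.1 h1).1]
  have h := hasDerivAt_integral_of_dominated_loc_of_deriv_le (μ := volume.restrict (Ioi (0 : ℝ)))
    (F := fun (q : ℂ) (t : ℝ) => (t : ℂ) ^ ((a - 1 : ℝ) : ℂ) * Complex.exp (-(q * t)))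
    (F' := fun (q : ℂ) (t : ℝ) => (t : ℂ) ^ ((a - 1 : ℝ) : ℂ) * (Complex.exp (-(q * t)) * -t))
    (x₀ := r) (bound := fun t => t ^ a * Real.exp (-(r.re / 2) * t))
    (Metric.ball_mem_nhds r (half_pos hr))
    (Filter.Eventually.of_forall fun q =>
      (continuousOn_cpow_mul_cexp_neg _ q).aestronglyMeasurable measurableSet_Ioi)
    (integrableOn_cpow_mul_cexp_neg (by linarith) hr)
    (by
      have := (continuousOn_cpow_mul_cexp_neg ((a - 1 : ℝ) : ℂ) r).mul
        (f := _) (g := fun t : ℝ => (-t : ℂ)) (by fun_prop)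
      refine (this.congr fun t _ => ?_).aestronglyMeasurable measurableSet_Ioi
      simp only [Pi.mul_apply]
      ring)
    (by
      filter_upwards [ae_restrict_mem measurableSet_Ioi] with t ht q hq
      have ht : 0 < t := ht
      rw [← mul_assoc, norm_mul, norm_cpow_mul_cexp_neg ht, norm_neg, Complex.norm_real,
        Real.norm_of_nonneg ht.le, mul_right_comm, ← Real.rpow_add_one ht.ne', sub_add_cancel]
      have := hball q hq
      gcongr)
    (integrableOn_rpow_mul_exp_neg_mul_Ioi (by linarith) (half_pos hr))
    (Filter.Eventually.of_forall fun t q _ => by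
      refine HasDerivAt.const_mul _ ?_
      have : HasDerivAt (fun q : ℂ => -(q * t)) (-t) q := by
        have := ((hasDerivAt_id q).mul_const (t : ℂ)).fun_neg
        rwa [one_mul] at this
      exact this.cexp)
  exact h.2.differentiableAt.differentiableWithinAt

/-- The Gamma integral `∫₀^∞ t^(a-1) e^(-rt) dt = r^(-a) Γ(a)` for complex `r` with `0 < re r`. -/
theorem integral_cpow_mul_cexp_neg_mul_Ioi_of_re_pos {a : ℝ} (ha : 0 < a) {r : ℂ}
    (hr : 0 < r.re) :
    ∫ t in Ioi (0 : ℝ), (t : ℂ) ^ ((a - 1 : ℝ) : ℂ) * Complex.exp (-(r * t))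
      = r ^ (-(a : ℂ)) * Complex.Gamma a := by
  have hopen : IsOpen {r : ℂ | 0 < r.re} := isOpen_lt continuous_const Complex.continuous_re
  have h1 := (differentiableOn_integral_cpow_mul_cexp_neg ha).analyticOnNhd hopen
  have h2 : AnalyticOnNhd ℂ (fun r : ℂ => r ^ (-(a : ℂ)) * Complex.Gamma a) {r | 0 < r.re} := by
    refine DifferentiableOn.analyticOnNhd (fun q hq => ?_) hopen
    exact ((differentiableAt_id.cpow_const (Or.inl hq)).mul_const _).differentiableWithinAt
  have hconn : IsPreconnected {r : ℂ | 0 < r.re} := (convex_halfSpace_re_gt 0).isPreconnected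
  refine h1.eqOn_of_preconnected_of_frequently_eq h2 hconn (z₀ := 1) (by simp) ?_ hr
  have hreal : ∀ x : ℝ, 0 < x → ∫ t in Ioi (0 : ℝ),
      (t : ℂ) ^ ((a - 1 : ℝ) : ℂ) * Complex.exp (-((x : ℂ) * t))
      = (x : ℂ) ^ (-(a : ℂ)) * Complex.Gamma a := by
    intro x hx
    have := Complex.integral_cpow_mul_exp_neg_mul_Ioi (a := (a : ℂ)) (r := x) (by simpa) hx
    push_cast
    rw [this, one_div, Complex.inv_cpow _ _ (by
      rw [Complex.arg_ofReal_of_nonneg hx.le]; exact Real.pi_pos.ne), Complex.cpow_neg]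
  have hseq : Filter.Tendsto (fun n : ℕ => ((1 + 1 / ((n : ℝ) + 1) : ℝ) : ℂ)) Filter.atTop
      (nhdsWithin 1 {1}ᶜ) := by
    refine tendsto_nhdsWithin_iff.2 ⟨?_, Filter.Eventually.of_forall fun n => ?_⟩
    · have := (tendsto_one_div_add_atTop_nhds_zero_nat (𝕜 := ℝ)).const_add 1
      have := (Complex.continuous_ofReal.tendsto _).comp this
      simpa [Function.comp_def] using this
    · have : (0 : ℝ) < 1 / ((n : ℝ) + 1) := by positivity
      simp only [mem_compl_iff, mem_singleton_iff]
      intro h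
      have h' : (1 + 1 / ((n : ℝ) + 1) : ℝ) = 1 := by exact_mod_cast h
      linarith
  exact hseq.frequently (Filter.Frequently.of_forall fun n => hreal _ (by positivity))

end GammaIntegral

namespace OEis

section Forms

variable {m : ℕ} {K : Type}

theorem sum_eq_first_add_mid_add_last {M : Type*} [AddCommMonoid M] (f : Fin (m + 2) → M) :
    ∑ i, f i = f ⟨0, by omega⟩ + (∑ i : Fin m, f ⟨(i : ℕ) + 1, by have := i.isLt; omega⟩
      + f ⟨m + 1, by omega⟩) := by
  rw [Fin.sum_univ_succ, Fin.sum_univ_castSucc]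
  rfl

theorem forall_iff_first_mid_last {p : Fin (m + 2) → Prop} :
    (∀ i, p i) ↔ p ⟨0, by omega⟩ ∧ (∀ i : Fin m, p ⟨(i : ℕ) + 1, by have := i.isLt; omega⟩) ∧
      p ⟨m + 1, by omega⟩ := by
  rw [Fin.forall_fin_succ, Fin.forall_fin_succ']
  rfl

variable [Field K]

theorem hyp_first_first (A : Matrix (Fin m) (Fin m) ℤ) :
    hyp A ⟨0, by omega⟩ ⟨0, by omega⟩ = 0 := by simp [hyp]

theorem hyp_first_last (A : Matrix (Fin m) (Fin m) ℤ) :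
    hyp A ⟨0, by omega⟩ ⟨m + 1, by omega⟩ = 1 := by simp [hyp]

theorem hyp_first_mid (A : Matrix (Fin m) (Fin m) ℤ) (j : Fin m) :
    hyp A ⟨0, by omega⟩ ⟨(j : ℕ) + 1, by have := j.isLt; omega⟩ = 0 := by
  have := j.isLt
  simp only [hyp, dif_pos]
  rw [if_neg]
  omega

theorem hyp_last_first (A : Matrix (Fin m) (Fin m) ℤ) :
    hyp A ⟨m + 1, by omega⟩ ⟨0, by omega⟩ = 1 := by simp [hyp]

theorem hyp_last_last (A : Matrix (Fin m) (Fin m) ℤ) :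
    hyp A ⟨m + 1, by omega⟩ ⟨m + 1, by omega⟩ = 0 := by simp [hyp]

theorem hyp_last_mid (A : Matrix (Fin m) (Fin m) ℤ) (j : Fin m) :
    hyp A ⟨m + 1, by omega⟩ ⟨(j : ℕ) + 1, by have := j.isLt; omega⟩ = 0 := by
  simp [hyp]

theorem hyp_mid_first (A : Matrix (Fin m) (Fin m) ℤ) (i : Fin m) :
    hyp A ⟨(i : ℕ) + 1, by have := i.isLt; omega⟩ ⟨0, by omega⟩ = 0 := by
  have := i.isLt.ne
  simp [hyp, this]

theorem hyp_mid_last (A : Matrix (Fin m) (Fin m) ℤ) (i : Fin m) :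
    hyp A ⟨(i : ℕ) + 1, by have := i.isLt; omega⟩ ⟨m + 1, by omega⟩ = 0 := by
  have := i.isLt
  simp [hyp]

theorem hyp_mid_mid (A : Matrix (Fin m) (Fin m) ℤ) (i j : Fin m) :
    hyp A ⟨(i : ℕ) + 1, by have := i.isLt; omega⟩ ⟨(j : ℕ) + 1, by have := j.isLt; omega⟩
      = A i j := by
  have h1 : (i : ℕ) ≠ m := i.isLt.ne
  have h2 : (j : ℕ) ≠ m := j.isLt.ne
  simp [hyp, h1, h2]

theorem hyp_mulVec_first (A : Matrix (Fin m) (Fin m) ℤ) (v : Fin (m + 2) → K) :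
    ((hyp A).map (Int.cast : ℤ → K)).mulVec v ⟨0, by omega⟩ = vlast v := by
  simp only [Matrix.mulVec, dotProduct, sum_eq_first_add_mid_add_last, Matrix.map_apply]
  simp only [hyp_first_first, hyp_first_mid, hyp_first_last, Int.cast_zero, Int.cast_one,
    zero_mul, one_mul, Finset.sum_const_zero, zero_add, vlast]

theorem hyp_mulVec_last (A : Matrix (Fin m) (Fin m) ℤ) (v : Fin (m + 2) → K) :
    ((hyp A).map (Int.cast : ℤ → K)).mulVec v ⟨m + 1, by omega⟩ = vfirst v := by
  simp only [Matrix.mulVec, dotProduct, sum_eq_first_add_mid_add_last, Matrix.map_apply]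
  simp only [hyp_last_first, hyp_last_mid, hyp_last_last, Int.cast_zero, Int.cast_one,
    zero_mul, one_mul, Finset.sum_const_zero, add_zero, vfirst]

theorem hyp_mulVec_mid (A : Matrix (Fin m) (Fin m) ℤ) (v : Fin (m + 2) → K) (i : Fin m) :
    ((hyp A).map (Int.cast : ℤ → K)).mulVec v ⟨(i : ℕ) + 1, by have := i.isLt; omega⟩
      = (A.map (Int.cast : ℤ → K)).mulVec (vmid v) i := by
  simp only [Matrix.mulVec, dotProduct, sum_eq_first_add_mid_add_last, Matrix.map_apply]
  simp only [hyp_mid_first, hyp_mid_mid, hyp_mid_last, Int.cast_zero, zero_mul, zero_add,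
    add_zero, vmid]

theorem bilin_hyp (A : Matrix (Fin m) (Fin m) ℤ) (u v : Fin (m + 2) → K) :
    bilin K (hyp A) u v
      = vfirst u * vlast v + vlast u * vfirst v + bilin K A (vmid u) (vmid v) := by
  rw [bilin, dotProduct, sum_eq_first_add_mid_add_last]
  simp only [hyp_mulVec_first, hyp_mulVec_last, hyp_mulVec_mid]
  simp only [vfirst, vlast, vmid, bilin, dotProduct]
  ring

theorem bilin_eq_sum (A : Matrix (Fin m) (Fin m) ℤ) (u v : Fin m → K) :
    bilin K A u v = ∑ i, ∑ j, u i * (A i j : K) * v j := by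
  simp [bilin, dotProduct, Matrix.mulVec, Finset.mul_sum, mul_assoc]

theorem bilin_add_left (A : Matrix (Fin m) (Fin m) ℤ) (u u' v : Fin m → K) :
    bilin K A (u + u') v = bilin K A u v + bilin K A u' v := by
  simp [bilin, add_dotProduct]

theorem bilin_add_right (A : Matrix (Fin m) (Fin m) ℤ) (u v v' : Fin m → K) :
    bilin K A u (v + v') = bilin K A u v + bilin K A u v' := by
  simp [bilin, Matrix.mulVec_add, dotProduct_add]

theorem bilin_smul_left (A : Matrix (Fin m) (Fin m) ℤ) (c : K) (u v : Fin m → K) :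
    bilin K A (c • u) v = c * bilin K A u v := by
  simp [bilin, smul_dotProduct]

theorem bilin_smul_right (A : Matrix (Fin m) (Fin m) ℤ) (c : K) (u v : Fin m → K) :
    bilin K A u (c • v) = c * bilin K A u v := by
  simp [bilin, Matrix.mulVec_smul, dotProduct_smul]

theorem bilin_neg_matrix (A : Matrix (Fin m) (Fin m) ℤ) (u v : Fin m → K) :
    bilin K (-A) u v = -bilin K A u v := by
  simp [bilin_eq_sum]

theorem bilin_comm {A : Matrix (Fin m) (Fin m) ℤ} (hA : A.IsSymm) (u v : Fin m → K) :
    bilin K A u v = bilin K A v u := by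
  rw [bilin_eq_sum, bilin_eq_sum, Finset.sum_comm]
  refine Finset.sum_congr rfl fun i _ => Finset.sum_congr rfl fun j _ => ?_
  rw [hA.apply]
  ring

theorem quadF_smul (A : Matrix (Fin m) (Fin m) ℤ) (c : K) (v : Fin m → K) :
    quadF K A (c • v) = c ^ 2 * quadF K A v := by
  rw [quadF, quadF, bilin_smul_left, bilin_smul_right]
  ring

theorem quadF_add [CharZero K] {A : Matrix (Fin m) (Fin m) ℤ} (hA : A.IsSymm)
    (u v : Fin m → K) : quadF K A (u + v) = quadF K A u + bilin K A u v + quadF K A v := by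
  rw [quadF, quadF, quadF, bilin_add_left, bilin_add_right, bilin_add_right, bilin_comm hA v u]
  ring

theorem quadF_hyp [CharZero K] (A : Matrix (Fin m) (Fin m) ℤ) (v : Fin (m + 2) → K) :
    quadF K (hyp A) v = vfirst v * vlast v + quadF K A (vmid v) := by
  rw [quadF, bilin_hyp, quadF]
  ring

theorem map_bilin {L : Type} [Field L] (f : K →+* L) (A : Matrix (Fin m) (Fin m) ℤ)
    (u v : Fin m → K) : f (bilin K A u v) = bilin L A (fun i => f (u i)) (fun i => f (v i)) := by
  simp [bilin_eq_sum, map_sum]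

theorem map_quadF {L : Type} [Field L] (f : K →+* L) (A : Matrix (Fin m) (Fin m) ℤ)
    (u : Fin m → K) : f (quadF K A u) = quadF L A (fun i => f (u i)) := by
  simp [quadF, map_bilin, map_ofNat]

theorem isSymm_hyp {A : Matrix (Fin m) (Fin m) ℤ} (hA : A.IsSymm) : (hyp A).IsSymm := by
  refine Matrix.IsSymm.ext ?_
  simp_rw [forall_iff_first_mid_last]
  simp only [hyp_first_mid, hyp_first_last, hyp_mid_first, hyp_mid_mid, hyp_mid_last,
    hyp_last_first, hyp_last_mid, hA.apply, implies_true, and_self]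

variable {n : ℕ} {S : Matrix (Fin n) (Fin n) ℤ}

theorem isSymm_MatS0 (hS : S.IsSymm) : (MatS0 n S).IsSymm :=
  isSymm_hyp hS.neg

theorem bilin_MatS0 (u v : Fin (n + 2) → K) :
    bilin K (MatS0 n S) u v
      = vfirst u * vlast v + vlast u * vfirst v - bilin K S (vmid u) (vmid v) := by
  rw [MatS0, bilin_hyp, bilin_neg_matrix]
  ring

theorem quadF_MatS0 [CharZero K] (v : Fin (n + 2) → K) :
    quadF K (MatS0 n S) v = vfirst v * vlast v - quadF K S (vmid v) := by
  rw [MatS0, quadF_hyp, quadF, bilin_neg_matrix, quadF]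
  ring

end Forms

end OEis

namespace OEis

section Bounds

theorem exists_pos_mul_norm_pow_le {ι : Type*} [Fintype ι] {K : Set (ι → ℝ)} (hK : IsClosed K)
    (hKs : ∀ t : ℝ, 0 < t → ∀ v ∈ K, t • v ∈ K) {f : (ι → ℝ) → ℝ} (hf : Continuous f) {p : ℕ}
    (hp : p ≠ 0) (hfs : ∀ (t : ℝ) (v : ι → ℝ), f (t • v) = t ^ p * f v)
    (hpos : ∀ v ∈ K, v ≠ 0 → 0 < f v) : ∃ c : ℝ, 0 < c ∧ ∀ v ∈ K, c * ‖v‖ ^ p ≤ f v := by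
  have key : ∃ c : ℝ, 0 < c ∧ ∀ v ∈ K ∩ Metric.sphere 0 1, c ≤ f v := by
    rcases (K ∩ Metric.sphere (0 : ι → ℝ) 1).eq_empty_or_nonempty with h | h
    · exact ⟨1, one_pos, by simp [h]⟩
    · obtain ⟨w, hw, hmin⟩ := ((isCompact_sphere (0 : ι → ℝ) 1).inter_left hK).exists_isMinOn h
        hf.continuousOn
      refine ⟨f w, hpos w hw.1 ?_, fun v hv => hmin hv⟩
      rintro rfl
      simpa using hw.2
  obtain ⟨c, hc, h⟩ := key
  refine ⟨c, hc, fun v hv => ?_⟩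
  by_cases hv0 : v = 0
  · have h0 := hfs 0 0
    rw [zero_smul, zero_pow hp, zero_mul] at h0
    simp [hv0, hp, h0]
  · have hn : 0 < ‖v‖ := norm_pos_iff.mpr hv0
    have h1 := h (‖v‖⁻¹ • v) ⟨hKs _ (inv_pos.mpr hn) v hv, by simp [norm_smul, hn.ne']⟩
    rw [hfs, inv_pow] at h1
    rwa [← le_div_iff₀ (by positivity), div_eq_inv_mul]

variable {m : ℕ}

theorem abs_bilin_le (A : Matrix (Fin m) (Fin m) ℤ) (u v : Fin m → ℝ) :
    |bilin ℝ A u v| ≤ (∑ i, ∑ j, |(A i j : ℝ)|) * (‖u‖ * ‖v‖) := by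
  rw [bilin_eq_sum, Finset.sum_mul]
  refine (Finset.abs_sum_le_sum_abs _ _).trans (Finset.sum_le_sum fun i _ => ?_)
  rw [Finset.sum_mul]
  refine (Finset.abs_sum_le_sum_abs _ _).trans (Finset.sum_le_sum fun j _ => ?_)
  rw [abs_mul, abs_mul, mul_comm |u i|, mul_assoc]
  gcongr
  · exact norm_le_pi_norm u i
  · exact norm_le_pi_norm v j

theorem continuous_bilin {X K : Type} [TopologicalSpace X] [NormedField K]
    (A : Matrix (Fin m) (Fin m) ℤ) {f g : X → Fin m → K}
    (hf : Continuous f) (hg : Continuous g) : Continuous fun x => bilin K A (f x) (g x) := by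
  simp only [bilin_eq_sum]
  fun_prop

theorem continuous_quadF {X K : Type} [TopologicalSpace X] [NormedField K]
    (A : Matrix (Fin m) (Fin m) ℤ) {f : X → Fin m → K}
    (hf : Continuous f) : Continuous fun x => quadF K A (f x) :=
  (continuous_bilin A hf hf).div_const 2

variable {n : ℕ} {S : Matrix (Fin n) (Fin n) ℤ}

theorem quadF_nonneg (hpos : ∀ v : Fin n → ℝ, v ≠ 0 → 0 < bilin ℝ S v v) (v : Fin n → ℝ) :
    0 ≤ quadF ℝ S v := by
  by_cases hv : v = 0
  · simp [hv, quadF, bilin]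
  · exact (half_pos (hpos v hv)).le

theorem bilin_sq_le (hsymm : S.IsSymm) (hpos : ∀ v : Fin n → ℝ, v ≠ 0 → 0 < bilin ℝ S v v)
    (u v : Fin n → ℝ) : bilin ℝ S u v ^ 2 ≤ 4 * (quadF ℝ S u * quadF ℝ S v) := by
  have h (t : ℝ) : 0 ≤ quadF ℝ S v * (t * t) + bilin ℝ S u v * t + quadF ℝ S u := by
    have := quadF_nonneg hpos (u + t • v)
    rw [quadF_add hsymm, bilin_smul_right, quadF_smul] at this
    linarith
  have := discrim_le_zero h
  rw [discrim] at this
  linarith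

theorem vfirst_pos_of_mem {y : Fin (n + 2) → ℝ} (hy : y ∈ PosCone n S) : 0 < vfirst y := hy.2

theorem vlast_pos_of_mem (hpos : ∀ v : Fin n → ℝ, v ≠ 0 → 0 < bilin ℝ S v v)
    {y : Fin (n + 2) → ℝ} (hy : y ∈ PosCone n S) : 0 < vlast y := by
  have h := hy.1
  rw [quadF_MatS0] at h
  have := quadF_nonneg hpos (vmid y)
  exact pos_of_mul_pos_right (by linarith) (vfirst_pos_of_mem hy).le

theorem quadF_neg_of_orthogonal (hsymm : S.IsSymm)
    (hpos : ∀ v : Fin n → ℝ, v ≠ 0 → 0 < bilin ℝ S v v)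
    {x y : Fin (n + 2) → ℝ} (hy : y ∈ PosCone n S) (hxy : bilin ℝ (MatS0 n S) x y = 0)
    (hx : x ≠ 0) : quadF ℝ (MatS0 n S) x < 0 := by
  have hf := vfirst_pos_of_mem hy
  have hl := vlast_pos_of_mem hpos hy
  have hq := hy.1
  rw [quadF_MatS0] at hq ⊢
  rw [bilin_MatS0] at hxy
  have hcs := bilin_sq_le hsymm hpos (vmid x) (vmid y)
  have hqy := quadF_nonneg hpos (vmid y)
  have hP : 0 < vfirst y * vlast y := mul_pos hf hl
  by_cases hx' : vmid x = 0
  · have h0 : quadF ℝ S (vmid x) = 0 := by simp [hx', quadF, bilin]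
    have h1 : bilin ℝ S (vmid x) (vmid y) = 0 := by simp [hx', bilin]
    rw [h1] at hxy
    rw [h0, sub_zero]
    have h2 : vlast x = -(vfirst x * vlast y) / vfirst y := by
      field_simp
      linarith
    have h3 : vfirst x ≠ 0 := by
      intro h3
      rw [h3] at h2
      refine hx (funext (forall_iff_first_mid_last.mpr ⟨h3, fun i => congrFun hx' i, ?_⟩))
      change vlast x = 0
      simp [h2]
    have : vfirst x * vlast x = -(vfirst x ^ 2 * vlast y / vfirst y) := by
      rw [h2]
      field_simp
    rw [this, neg_lt_zero]
    positivity
  · have h0 : 0 < quadF ℝ S (vmid x) := half_pos (hpos _ hx')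
    have h1 : bilin ℝ S (vmid x) (vmid y) = vfirst x * vlast y + vlast x * vfirst y := by linarith
    rw [h1] at hcs
    have h2 : vfirst x * vlast x * (vfirst y * vlast y)
        < quadF ℝ S (vmid x) * (vfirst y * vlast y) := by
      nlinarith [sq_nonneg (vfirst x * vlast y - vlast x * vfirst y)]
    linarith [lt_of_mul_lt_mul_right h2 hP.le]

theorem bilin_self {K : Type} [Field K] [CharZero K] (A : Matrix (Fin m) (Fin m) ℤ)
    (v : Fin m → K) : bilin K A v v = 2 * quadF K A v := by
  rw [quadF]
  ring

theorem mul_quadF_le_bilin_sq (hsymm : S.IsSymm)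
    (hpos : ∀ v : Fin n → ℝ, v ≠ 0 → 0 < bilin ℝ S v v)
    (x : Fin (n + 2) → ℝ) {y : Fin (n + 2) → ℝ} (hy : y ∈ PosCone n S) :
    4 * (quadF ℝ (MatS0 n S) x * quadF ℝ (MatS0 n S) y) ≤ bilin ℝ (MatS0 n S) x y ^ 2 := by
  set A := quadF ℝ (MatS0 n S) y with hA
  have hA0 : 0 < A := hy.1
  set b := bilin ℝ (MatS0 n S) x y with hb
  set t : ℝ := -(b / (2 * A)) with ht
  have h1 : bilin ℝ (MatS0 n S) (x + t • y) y = 0 := by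
    rw [bilin_add_left, bilin_smul_left, bilin_self, ← hA, ← hb, ht]
    field_simp
    ring
  have h2 : quadF ℝ (MatS0 n S) (x + t • y) ≤ 0 := by
    by_cases h : x + t • y = 0
    · simp [h, quadF, bilin]
    · exact (quadF_neg_of_orthogonal hsymm hpos hy h1 h).le
  rw [quadF_add (isSymm_MatS0 hsymm), bilin_smul_right, quadF_smul, ← hA, ← hb] at h2
  have h3 : t * b + t ^ 2 * A = -(b ^ 2 / (4 * A)) := by
    rw [ht]
    field_simp
    ring
  have h4 : quadF ℝ (MatS0 n S) x ≤ b ^ 2 / (4 * A) := by linarith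
  rw [le_div_iff₀ (by positivity)] at h4
  linarith

theorem quadF_re_add_im {A : Matrix (Fin m) (Fin m) ℤ} (hA : A.IsSymm) (x y : Fin m → ℝ) :
    quadF ℂ A (fun i => (x i : ℂ) + y i * Complex.I)
      = ((quadF ℝ A x - quadF ℝ A y : ℝ) : ℂ) + ((bilin ℝ A x y : ℝ) : ℂ) * Complex.I := by
  have h : (fun i => (x i : ℂ) + y i * Complex.I)
      = (fun i => (x i : ℂ)) + Complex.I • (fun i => (y i : ℂ)) := by
    ext i
    simp [mul_comm]
  have h1 : ((bilin ℝ A x y : ℝ) : ℂ) = _ := map_bilin Complex.ofRealHom A x y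
  have h2 (x : Fin m → ℝ) : ((quadF ℝ A x : ℝ) : ℂ) = _ := map_quadF Complex.ofRealHom A x
  rw [h, quadF_add hA, bilin_smul_right, quadF_smul, Complex.ofReal_sub, h1, h2, h2, Complex.I_sq]
  simp only [Complex.ofRealHom_eq_coe]
  ring

theorem exists_pos_mul_le_norm_quadF (hsymm : S.IsSymm)
    (hpos : ∀ v : Fin n → ℝ, v ≠ 0 → 0 < bilin ℝ S v v)
    {z : Fin (n + 2) → ℂ} (hz : z ∈ HS n S) :
    ∃ c : ℝ, 0 < c ∧ ∀ x : Fin (n + 2) → ℝ,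
      c * (1 + ‖x‖) ≤ ‖quadF ℂ (MatS0 n S) (fun i => z i + x i)‖ := by
  set y : Fin (n + 2) → ℝ := fun i => (z i).im with hy
  set x₀ : Fin (n + 2) → ℝ := fun i => (z i).re with hx₀
  have hyP : y ∈ PosCone n S := hz
  set A := quadF ℝ (MatS0 n S) y with hA
  have hA0 : 0 < A := hyP.1
  obtain ⟨c, hc, hcx⟩ := exists_pos_mul_norm_pow_le (K := (Set.univ : Set (Fin (n + 2) → ℝ)))
    isClosed_univ (by simp)
    (f := fun x => bilin ℝ (MatS0 n S) x y ^ 2 / 2 - A * quadF ℝ (MatS0 n S) x)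
    (by
      have := continuous_bilin (K := ℝ) (MatS0 n S) (f := fun x => x) (g := fun _ => y)
        continuous_id continuous_const
      have := continuous_quadF (K := ℝ) (MatS0 n S) (f := fun x => x) continuous_id
      fun_prop)
    (p := 2) two_ne_zero
    (by
      intro t v
      simp only [bilin_smul_left, quadF_smul]
      ring)
    (by
      intro v _ hv
      by_cases h : bilin ℝ (MatS0 n S) v y = 0
      · have := quadF_neg_of_orthogonal hsymm hpos hyP h hv
        simp only [h]
        nlinarith
      · have h1 := mul_quadF_le_bilin_sq hsymm hpos v hyP
        have : 0 < bilin ℝ (MatS0 n S) v y ^ 2 := by positivity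
        simp only [← hA] at h1 ⊢
        nlinarith)
  refine ⟨min A (Real.sqrt c) / 2 / (1 + ‖x₀‖), ?_, fun x => ?_⟩
  · have := Real.sqrt_pos.mpr hc
    positivity
  have hx0 : 0 ≤ ‖x₀‖ := norm_nonneg _
  have hxx : 1 + ‖x‖ ≤ (1 + ‖x₀‖) * (1 + ‖x₀ + x‖) := by
    have : ‖x‖ ≤ ‖x₀ + x‖ + ‖x₀‖ := by
      simpa using norm_sub_le (x₀ + x) x₀
    nlinarith [norm_nonneg (x₀ + x)]
  have hzx : (fun i => z i + x i)
      = fun i => (((x₀ + x) i : ℝ) : ℂ) + y i * Complex.I := by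
    ext i
    conv_lhs => rw [← Complex.re_add_im (z i)]
    simp only [hx₀, hy, Pi.add_apply, Complex.ofReal_add]
    ring
  set w := x₀ + x with hw
  rw [hzx, quadF_re_add_im (isSymm_MatS0 hsymm), Complex.norm_add_mul_I]
  have hcw := hcx w (Set.mem_univ _)
  have h5 : min A (Real.sqrt c) / 2 * (1 + ‖w‖) ≤ Real.sqrt ((quadF ℝ (MatS0 n S) w - A) ^ 2
      + bilin ℝ (MatS0 n S) w y ^ 2) := by
    apply Real.le_sqrt_of_sq_le
    have h6 : min A (Real.sqrt c) ≤ A := min_le_left _ _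
    have h7 : min A (Real.sqrt c) ^ 2 ≤ c := by
      have : min A (Real.sqrt c) ≤ Real.sqrt c := min_le_right _ _
      have h8 : 0 ≤ min A (Real.sqrt c) := le_min hA0.le (Real.sqrt_nonneg _)
      calc _ ≤ Real.sqrt c ^ 2 := by gcongr
        _ = c := Real.sq_sqrt hc.le
    have h8 : min A (Real.sqrt c) ^ 2 ≤ A ^ 2 := by
      have h8 : 0 ≤ min A (Real.sqrt c) := le_min hA0.le (Real.sqrt_nonneg _)
      gcongr
    have h9 : (1 + ‖w‖) ^ 2 ≤ 2 * (1 + ‖w‖ ^ 2) := by nlinarith [sq_nonneg (1 - ‖w‖)]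
    have h10 : (min A (Real.sqrt c) / 2 * (1 + ‖w‖)) ^ 2
        ≤ min A (Real.sqrt c) ^ 2 / 4 * (2 * (1 + ‖w‖ ^ 2)) := by
      rw [mul_pow, div_pow]
      norm_num
      gcongr
    have h11 : min A (Real.sqrt c) ^ 2 * ‖w‖ ^ 2 ≤ c * ‖w‖ ^ 2 := by gcongr
    nlinarith [sq_nonneg (quadF ℝ (MatS0 n S) w)]
  refine le_trans ?_ h5
  rw [div_mul_eq_mul_div, div_le_iff₀ (by positivity), mul_assoc]
  have : 0 ≤ min A (Real.sqrt c) / 2 := by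
    have := le_min hA0.le (Real.sqrt_nonneg c)
    positivity
  refine mul_le_mul_of_nonneg_left ?_ this
  linarith

theorem exists_pos_mul_norm_le_bilin (hsymm : S.IsSymm)
    (hpos : ∀ v : Fin n → ℝ, v ≠ 0 → 0 < bilin ℝ S v v)
    {y : Fin (n + 2) → ℝ} (hy : y ∈ PosCone n S) :
    ∃ c : ℝ, 0 < c ∧ ∀ v ∈ PosCone n S, c * ‖v‖ ≤ bilin ℝ (MatS0 n S) v y := by
  have hcont := continuous_bilin (K := ℝ) (MatS0 n S) (f := fun x => x) (g := fun _ => y)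
        continuous_id continuous_const
  have hcont' := continuous_quadF (K := ℝ) (MatS0 n S) (f := fun x => x) continuous_id
  obtain ⟨c, hc, h⟩ := exists_pos_mul_norm_pow_le
    (K := {v : Fin (n + 2) → ℝ | 0 ≤ quadF ℝ (MatS0 n S) v} ∩
      ({v | 0 ≤ vfirst v} ∩ {v | 0 ≤ vlast v}))
    ((isClosed_le continuous_const hcont').inter
      ((isClosed_le continuous_const (continuous_apply _)).inter
        (isClosed_le continuous_const (continuous_apply _))))
    (by
      rintro t ht v ⟨h1, h2, h3⟩
      simp only [Set.mem_ofPred_eq, Set.mem_inter_iff] at h1 h2 h3 ⊢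
      rw [quadF_smul]
      exact ⟨by positivity, mul_nonneg ht.le h2, mul_nonneg ht.le h3⟩)
    hcont (p := 1) one_ne_zero
    (by
      intro t v
      simp [bilin_smul_left])
    (by
      rintro v ⟨h1, h2, h3⟩ hv
      simp only [Set.mem_ofPred_eq] at h1 h2 h3
      have h0 : bilin ℝ (MatS0 n S) v y ≠ 0 := fun h0 =>
        absurd (quadF_neg_of_orthogonal hsymm hpos hy h0 hv) (not_lt.mpr h1)
      refine lt_of_le_of_ne ?_ h0.symm
      have hq := hy.1
      rw [quadF_MatS0] at hq h1
      rw [bilin_MatS0]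
      have hf := vfirst_pos_of_mem hy
      have hl := vlast_pos_of_mem hpos hy
      have hcs := bilin_sq_le hsymm hpos (vmid v) (vmid y)
      have h4 := quadF_nonneg hpos (vmid y)
      have h5 : quadF ℝ S (vmid v) * quadF ℝ S (vmid y)
          ≤ (vfirst v * vlast v) * (vfirst y * vlast y) := by
        gcongr
        · linarith
        · linarith
      have h6 : bilin ℝ S (vmid v) (vmid y) ≤ vfirst v * vlast y + vlast v * vfirst y := by
        refine le_of_sq_le_sq ?_ (by positivity)
        nlinarith [sq_nonneg (vfirst v * vlast y - vlast v * vfirst y)]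
      linarith)
  refine ⟨c, hc, fun v hv => ?_⟩
  simpa using h v ⟨hv.1.le, (vfirst_pos_of_mem hv).le, (vlast_pos_of_mem hpos hv).le⟩

/-- The function `v ↦ Q₀(v)^a e^{2πi(v,z)₀}` on the positive cone, extended by zero. -/
noncomputable def coneFun (n : ℕ) (S : Matrix (Fin n) (Fin n) ℤ) (a : ℝ) (z : Fin (n + 2) → ℂ) :
    (Fin (n + 2) → ℝ) → ℂ :=
  (PosCone n S).indicator fun v => ((quadF ℝ (MatS0 n S) v ^ a : ℝ) : ℂ) *
    Complex.exp (2 * Real.pi * Complex.I * bilin ℂ (MatS0 n S) (fun i => (v i : ℂ)) z)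

theorem isOpen_PosCone : IsOpen (PosCone n S) :=
  (isOpen_lt continuous_const (continuous_quadF (K := ℝ) (MatS0 n S) (f := fun x => x)
    continuous_id)).inter (isOpen_lt continuous_const (continuous_apply _))

theorem continuous_coneFun (hpos : ∀ v : Fin n → ℝ, v ≠ 0 → 0 < bilin ℝ S v v) {a : ℝ}
    (ha : 0 < a) (z : Fin (n + 2) → ℂ) : Continuous (coneFun n S a z) := by
  have hq := continuous_quadF (K := ℝ) (MatS0 n S) (f := fun x => x) continuous_id
  refine continuous_indicator (fun v hv => ?_) (Continuous.continuousOn ?_)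
  · have hcl : v ∈ {v : Fin (n + 2) → ℝ | 0 ≤ quadF ℝ (MatS0 n S) v} ∩ {v | 0 ≤ vfirst v} := by
      refine closure_minimal ?_ ((isClosed_le continuous_const hq).inter
        (isClosed_le continuous_const (continuous_apply _))) (frontier_subset_closure hv)
      exact fun w hw => ⟨hw.1.le, hw.2.le⟩
    rw [isOpen_PosCone.frontier_eq] at hv
    have h1 : 0 ≤ quadF ℝ (MatS0 n S) v := hcl.1
    have h0 : quadF ℝ (MatS0 n S) v = 0 := by
      refine le_antisymm (not_lt.mp fun hlt => hv.2 ⟨hlt, lt_of_le_of_ne hcl.2 fun hf => ?_⟩) h1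
      rw [quadF_MatS0, show vfirst v = 0 from hf.symm, zero_mul, zero_sub] at hlt
      linarith [quadF_nonneg hpos (vmid v)]
    simp [h0, Real.zero_rpow ha.ne']
  · have h1 : Continuous fun v : Fin (n + 2) → ℝ => quadF ℝ (MatS0 n S) v ^ a :=
      hq.rpow_const fun _ => Or.inr ha.le
    have h2 := continuous_bilin (K := ℂ) (MatS0 n S) (f := fun v : Fin (n + 2) → ℝ =>
      fun i => (v i : ℂ)) (g := fun _ => z) (by fun_prop) continuous_const
    fun_prop

theorem bilin_im (A : Matrix (Fin m) (Fin m) ℤ) (v : Fin m → ℝ) (z : Fin m → ℂ) :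
    (bilin ℂ A (fun i => (v i : ℂ)) z).im = bilin ℝ A v fun i => (z i).im := by
  simp only [bilin_eq_sum, Complex.im_sum]
  refine Finset.sum_congr rfl fun i _ => Finset.sum_congr rfl fun j _ => ?_
  rw [← Complex.ofReal_intCast, ← Complex.ofReal_mul, Complex.im_ofReal_mul]

theorem norm_exp_two_pi_I_mul (w : ℂ) :
    ‖Complex.exp (2 * Real.pi * Complex.I * w)‖ = Real.exp (-(2 * Real.pi * w.im)) := by
  rw [Complex.norm_exp]
  congr 1
  simp [mul_assoc]

theorem exists_norm_coneFun_le (hsymm : S.IsSymm)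
    (hpos : ∀ v : Fin n → ℝ, v ≠ 0 → 0 < bilin ℝ S v v) {a : ℝ} (ha : 0 ≤ a)
    {z : Fin (n + 2) → ℂ} (hz : z ∈ HS n S) (r : ℕ) :
    ∃ C : ℝ, 0 ≤ C ∧ ∀ v, ‖coneFun n S a z v‖ ≤ C * ((1 + ‖v‖) ^ r)⁻¹ := by
  obtain ⟨c, hc, hcv⟩ := exists_pos_mul_norm_le_bilin hsymm hpos hz
  set M : ℝ := ∑ i, ∑ j, |(MatS0 n S i j : ℝ)| with hM
  have hM0 : 0 ≤ M := by positivity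
  set e : ℝ := 2 * Real.pi * c with he
  have he0 : 0 < e := by positivity
  set s : ℕ := 2 * ⌈a⌉₊ + r with hs
  refine ⟨(1 + M) ^ ⌈a⌉₊ * (Real.exp e * (s.factorial / e ^ s)), by positivity, fun v => ?_⟩
  by_cases hv : v ∈ PosCone n S
  swap
  · rw [coneFun, Set.indicator_of_notMem hv, norm_zero]
    positivity
  rw [coneFun, Set.indicator_of_mem hv, norm_mul, norm_exp_two_pi_I_mul, bilin_im, Complex.norm_real,
    Real.norm_of_nonneg (Real.rpow_nonneg hv.1.le _)]
  set x := 1 + ‖v‖ with hx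
  have hx1 : 1 ≤ x := by simp [hx]
  have hx0 : 0 < x := by linarith
  have h1 : quadF ℝ (MatS0 n S) v ≤ (1 + M) * x ^ 2 := by
    have h := (le_abs_self _).trans (abs_bilin_le (MatS0 n S) v v)
    rw [bilin_self] at h
    have h2 : ‖v‖ * ‖v‖ ≤ x ^ 2 := by nlinarith [norm_nonneg v]
    have h3 : M * (‖v‖ * ‖v‖) ≤ M * x ^ 2 := by gcongr
    have h4 := hv.1
    nlinarith
  have h2 : quadF ℝ (MatS0 n S) v ^ a ≤ ((1 + M) * x ^ 2) ^ ⌈a⌉₊ := by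
    calc quadF ℝ (MatS0 n S) v ^ a ≤ ((1 + M) * x ^ 2) ^ a :=
          Real.rpow_le_rpow hv.1.le h1 ha
      _ ≤ ((1 + M) * x ^ 2) ^ ((⌈a⌉₊ : ℕ) : ℝ) :=
          Real.rpow_le_rpow_of_exponent_le (by nlinarith) (Nat.le_ceil a)
      _ = _ := Real.rpow_natCast _ _
  have h3 : Real.exp (-(2 * Real.pi * bilin ℝ (MatS0 n S) v fun i => (z i).im))
      ≤ Real.exp e * Real.exp (-(e * x)) := by
    rw [← Real.exp_add]
    apply Real.exp_le_exp.mpr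
    have := hcv v hv
    have : 2 * Real.pi * (c * ‖v‖) ≤ 2 * Real.pi * bilin ℝ (MatS0 n S) v fun i => (z i).im := by
      gcongr
    rw [he, hx]
    linarith
  have h4 : Real.exp (-(e * x)) ≤ s.factorial / e ^ s * (x ^ s)⁻¹ := by
    have := Real.pow_div_factorial_le_exp (e * x) (by positivity) s
    rw [Real.exp_neg]
    calc (Real.exp (e * x))⁻¹ ≤ ((e * x) ^ s / s.factorial)⁻¹ := by gcongr
      _ = _ := by
        rw [inv_div, mul_pow]
        field_simp
  calc _ ≤ ((1 + M) * x ^ 2) ^ ⌈a⌉₊ * (Real.exp e * (s.factorial / e ^ s * (x ^ s)⁻¹)) := by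
        refine mul_le_mul h2 (h3.trans ?_) (Real.exp_nonneg _) (by positivity)
        gcongr
    _ = _ := by
      have hsx : x ^ s = x ^ (2 * ⌈a⌉₊) * x ^ r := by rw [hs, pow_add]
      rw [hsx, mul_pow, ← pow_mul]
      field_simp

end Bounds

end OEis

namespace OEis

open MeasureTheory

theorem integral_comp_mulVec {ι E : Type*} [Fintype ι] [DecidableEq ι] [NormedAddCommGroup E]
    [NormedSpace ℝ E] {M : Matrix ι ι ℝ} (hM : M.det ≠ 0) (f : (ι → ℝ) → E) :
    ∫ x, f (M.mulVec x) = |M.det|⁻¹ • ∫ x, f x := by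
  have hinj : LinearMap.det (Matrix.toLin' M) ≠ 0 := by rwa [LinearMap.det_toLin']
  let e : (ι → ℝ) ≃ₗ[ℝ] (ι → ℝ) := LinearEquiv.ofIsUnitDet (f := Matrix.toLin' M)
    (v := Pi.basisFun ℝ ι) (v' := Pi.basisFun ℝ ι)
    (by rw [LinearMap.toMatrix_eq_toMatrix', LinearMap.toMatrix'_toLin']; exact hM.isUnit)
  have he : MeasurableEmbedding (Matrix.toLin' M) :=
    e.toContinuousLinearEquiv.toHomeomorph.measurableEmbedding
  have := he.integral_map (μ := volume) f
  simp only [Matrix.toLin'_apply] at this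
  rw [← this, Real.map_matrix_volume_pi_eq_smul_volume_pi hM, integral_smul_measure, abs_inv,
    ENNReal.toReal_ofReal (by positivity)]

variable {n : ℕ} {S : Matrix (Fin n) (Fin n) ℤ}

theorem posDef_map_intCast (hsymm : S.IsSymm)
    (hpos : ∀ v : Fin n → ℝ, v ≠ 0 → 0 < bilin ℝ S v v) :
    (S.map (Int.cast : ℤ → ℝ)).PosDef := by
  refine Matrix.PosDef.of_dotProduct_mulVec_pos ?_ fun v hv => ?_
  · ext i j
    simp [hsymm.apply]
  · simpa [bilin] using hpos v hv

theorem det_map_intCast : (S.map (Int.cast : ℤ → ℝ)).det = ((S.det : ℤ) : ℝ) :=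
  ((Int.castRingHom ℝ).map_det S).symm

theorem det_pos (hsymm : S.IsSymm) (hpos : ∀ v : Fin n → ℝ, v ≠ 0 → 0 < bilin ℝ S v v) :
    (0 : ℝ) < ((S.det : ℤ) : ℝ) := by
  rw [← det_map_intCast]
  exact (posDef_map_intCast hsymm hpos).det_pos

open scoped MatrixOrder in
theorem exists_map_eq_transpose_mul_self (hsymm : S.IsSymm)
    (hpos : ∀ v : Fin n → ℝ, v ≠ 0 → 0 < bilin ℝ S v v) :
    ∃ A : Matrix (Fin n) (Fin n) ℝ, S.map (Int.cast : ℤ → ℝ) = A.transpose * A := by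
  obtain ⟨A, hA⟩ := CStarAlgebra.nonneg_iff_eq_star_mul_self.mp
    (posDef_map_intCast hsymm hpos).posSemidef.nonneg
  exact ⟨A, by rw [hA, Matrix.star_eq_conjTranspose, Matrix.conjTranspose_eq_transpose_of_trivial]⟩

theorem bilin_eq_sum_mulVec {A : Matrix (Fin n) (Fin n) ℝ}
    (hA : S.map (Int.cast : ℤ → ℝ) = A.transpose * A) (u w : Fin n → ℂ) :
    bilin ℂ S u w
      = ∑ i, (A.map (Complex.ofReal)).mulVec u i * (A.map (Complex.ofReal)).mulVec w i := by
  have h : S.map (Int.cast : ℤ → ℂ)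
      = (A.map (Complex.ofReal)).transpose * (A.map (Complex.ofReal)) := by
    have h1 : S.map (Int.cast : ℤ → ℂ) = (S.map (Int.cast : ℤ → ℝ)).map Complex.ofReal := by
      ext i j
      simp
    rw [h1, hA, ← Matrix.transpose_map]
    exact Matrix.map_mul (f := Complex.ofRealHom)
  rw [bilin, h, ← Matrix.mulVec_mulVec, Matrix.dotProduct_mulVec, Matrix.vecMul_transpose]
  rfl

theorem integral_cexp_neg_mul_quadF_add (hsymm : S.IsSymm)
    (hpos : ∀ v : Fin n → ℝ, v ≠ 0 → 0 < bilin ℝ S v v) {b : ℂ} (hb : 0 < b.re) (c : ℂ)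
    (w : Fin n → ℂ) :
    ∫ x : Fin n → ℝ, Complex.exp (-(b * quadF ℂ S fun i => (x i : ℂ))
        + c * bilin ℂ S (fun i => (x i : ℂ)) w)
      = ((Real.sqrt ((S.det : ℤ) : ℝ) : ℝ) : ℂ)⁻¹ * (2 * Real.pi / b) ^ (n / 2 : ℂ)
        * Complex.exp (c ^ 2 / b * quadF ℂ S w) := by
  obtain ⟨A, hA⟩ := exists_map_eq_transpose_mul_self hsymm hpos
  have hdet : A.det ^ 2 = ((S.det : ℤ) : ℝ) := by
    rw [← det_map_intCast, hA, Matrix.det_mul, Matrix.det_transpose, sq]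
  have hdpos := det_pos hsymm hpos
  have hA0 : A.det ≠ 0 := by
    intro h
    rw [h] at hdet
    norm_num at hdet
    exact hdpos.ne hdet
  set A' := A.map Complex.ofReal with hA'
  have hreal (x : Fin n → ℝ) (i : Fin n) :
      A'.mulVec (fun i => (x i : ℂ)) i = ((A.mulVec x i : ℝ) : ℂ) := by
    simp [hA', Matrix.mulVec, dotProduct]
  have hb2 : 0 < (b / 2).re := by
    rw [show b / 2 = b / ((2 : ℝ) : ℂ) by norm_num, Complex.div_ofReal_re]
    exact half_pos hb
  have hb0 : b ≠ 0 := by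
    rintro rfl
    simp at hb
  have key (x : Fin n → ℝ) : -(b * quadF ℂ S fun i => (x i : ℂ))
        + c * bilin ℂ S (fun i => (x i : ℂ)) w
      = -(b / 2) * ∑ i, ((A.mulVec x i : ℝ) : ℂ) ^ 2
        + ∑ i, c * A'.mulVec w i * ((A.mulVec x i : ℝ) : ℂ) := by
    rw [quadF, bilin_eq_sum_mulVec hA, bilin_eq_sum_mulVec hA, Finset.mul_sum]
    simp only [← hA', hreal]
    congr 1
    · simp only [← sq]
      ring
    · exact Finset.sum_congr rfl fun i _ => by ring
  simp_rw [key]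
  rw [integral_comp_mulVec hA0 (fun y : Fin n → ℝ => Complex.exp (-(b / 2) * ∑ i, (y i : ℂ) ^ 2
        + ∑ i, c * A'.mulVec w i * (y i : ℂ))),
    GaussianFourier.integral_cexp_neg_mul_sum_add hb2, ← hdet, Real.sqrt_sq_eq_abs,
    Complex.real_smul, mul_assoc, Fintype.card_fin, Complex.ofReal_inv]
  congr 3
  · field_simp
  · rw [quadF, bilin_eq_sum_mulVec hA, ← hA']
    simp only [mul_pow, ← Finset.mul_sum, ← sq]
    field_simp
    ring

end OEis

namespace OEis

open MeasureTheory

/-- The vector `(l, μᵀ, m)ᵀ` over an arbitrary type. -/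
def glue {n : ℕ} {K : Type} (l : K) (μ : Fin n → K) (m : K) : Fin (n + 2) → K :=
  (Fin.last (n + 1)).insertNth (α := fun _ => K) m ((0 : Fin (n + 1)).insertNth (α := fun _ => K) l μ)

section Glue

variable {n : ℕ} {K : Type} (l : K) (μ : Fin n → K) (m : K)

@[simp] theorem vlast_glue : vlast (glue l μ m) = m :=
  Fin.insertNth_apply_same (α := fun _ => K) (Fin.last (n + 1)) m _

@[simp] theorem vfirst_glue : vfirst (glue l μ m) = l := by
  rw [glue, Fin.insertNth_last', Fin.insertNth_zero', vfirst]
  exact (Fin.snoc_castSucc (α := fun _ => K) m _ 0).trans rfl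

@[simp] theorem vmid_glue : vmid (glue l μ m) = μ := by
  ext i
  rw [glue, Fin.insertNth_last', Fin.insertNth_zero', vmid]
  exact (Fin.snoc_castSucc (α := fun _ => K) m _ i.succ).trans rfl

theorem integral_eq_integral_glue {f : (Fin (n + 2) → ℝ) → ℂ} (hf : Integrable f) :
    ∫ v, f v = ∫ m : ℝ, ∫ μ : Fin n → ℝ, ∫ l : ℝ, f (glue l μ m) := by
  have h1 := (volume_preserving_piFinSuccAbove (fun _ : Fin (n + 2) => ℝ) (Fin.last (n + 1))).symm
  have h2 := (volume_preserving_piFinSuccAbove (fun _ : Fin (n + 1) => ℝ) 0).symm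
  rw [← h1.integral_comp' f, Measure.volume_eq_prod, integral_prod]
  swap
  · exact (h1.integrable_comp_emb (MeasurableEquiv.measurableEmbedding _)).mpr hf
  have hi := (h1.integrable_comp_emb (MeasurableEquiv.measurableEmbedding _)).mpr hf
  rw [Measure.volume_eq_prod] at hi
  refine integral_congr_ae ?_
  filter_upwards [hi.prod_right_ae] with m hm
  rw [← h2.integral_comp', Measure.volume_eq_prod, integral_prod_symm]
  · rfl
  · exact (h2.integrable_comp_emb (MeasurableEquiv.measurableEmbedding _)).mpr hm

end Glue

theorem ofReal_mul_cpow {r : ℝ} (hr : 0 < r) {x : ℂ} (hx : x ≠ 0) (s : ℂ) :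
    ((r : ℂ) * x) ^ s = (r : ℂ) ^ s * x ^ s := by
  have hr' : (r : ℂ) ≠ 0 := Complex.ofReal_ne_zero.mpr hr.ne'
  rw [Complex.cpow_def_of_ne_zero (mul_ne_zero hr' hx), Complex.cpow_def_of_ne_zero hr',
    Complex.cpow_def_of_ne_zero hx, Complex.log_ofReal_mul hr hx, add_mul, Complex.exp_add,
    Complex.ofReal_log hr.le]

variable {n : ℕ} {S : Matrix (Fin n) (Fin n) ℤ}

theorem im_vfirst_sub_pos (hsymm : S.IsSymm)
    (hpos : ∀ v : Fin n → ℝ, v ≠ 0 → 0 < bilin ℝ S v v) {z : Fin (n + 2) → ℂ}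
    (hz : z ∈ HS n S) : 0 < (vfirst z - quadF ℂ S (vmid z) / vlast z).im := by
  set x := fun i => (vmid z i).re with hx
  set y := fun i => (vmid z i).im with hy
  have hzxy : vmid z = fun i => (x i : ℂ) + y i * Complex.I :=
    funext fun i => (Complex.re_add_im _).symm
  have ht : 0 < (vlast z).im := vlast_pos_of_mem hpos hz
  have hq : quadF ℝ S y < (vfirst z).im * (vlast z).im := by
    have := hz.1
    rw [quadF_MatS0] at this
    exact sub_pos.mp this
  have hns : 0 < (vlast z).re ^ 2 + (vlast z).im ^ 2 := by positivity
  have hform := quadF_nonneg hpos (((vlast z).re) • y + (-(vlast z).im) • x)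
  rw [quadF_add hsymm, quadF_smul, quadF_smul, bilin_smul_left, bilin_smul_right,
    bilin_comm hsymm] at hform
  rw [hzxy, quadF_re_add_im hsymm, Complex.sub_im, Complex.div_im, sub_pos]
  simp only [Complex.add_re, Complex.add_im, Complex.ofReal_re, Complex.ofReal_im, Complex.mul_re,
    Complex.mul_im, Complex.I_re, Complex.I_im, Complex.normSq_apply, mul_zero, mul_one, sub_zero,
    zero_add, add_zero]
  rw [← sub_div, div_lt_iff₀ (by nlinarith)]
  refine lt_of_mul_lt_mul_right ?_ ht.le
  nlinarith

theorem integral_coneFun_first (hpos : ∀ v : Fin n → ℝ, v ≠ 0 → 0 < bilin ℝ S v v) {a : ℝ}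
    (ha : 0 < a) {z : Fin (n + 2) → ℂ} (hz : z ∈ HS n S) {m : ℝ} (hm : 0 < m) (μ : Fin n → ℝ) :
    ∫ l : ℝ, coneFun n S a z (glue l μ m)
      = ((m ^ a : ℝ) : ℂ) * Complex.exp (2 * Real.pi * Complex.I * (m * vfirst z)) *
        ((-(2 * Real.pi * Complex.I * vlast z)) ^ (-((a + 1 : ℝ) : ℂ)) * Complex.Gamma (a + 1 : ℝ)) *
        Complex.exp (-(-(2 * Real.pi * Complex.I * vlast z) / m * quadF ℂ S fun i => (μ i : ℂ))
          + -(2 * Real.pi * Complex.I) * bilin ℂ S (fun i => (μ i : ℂ)) (vmid z)) := by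
  set w : ℂ := -(2 * Real.pi * Complex.I * vlast z) with hw
  have hwre : 0 < w.re := by
    have : 0 < (vlast z).im := vlast_pos_of_mem hpos hz
    have h2 : w.re = 2 * Real.pi * (vlast z).im := by
      simp [hw, mul_assoc]
    rw [h2]
    positivity
  set q := quadF ℝ S μ with hq
  have hq0 : 0 ≤ q := quadF_nonneg hpos μ
  have hqC : quadF ℂ S (fun i => (μ i : ℂ)) = (q : ℂ) := (map_quadF Complex.ofRealHom S μ).symm
  have hmC : (m : ℂ) ≠ 0 := Complex.ofReal_ne_zero.mpr hm.ne'
  rw [← integral_add_right_eq_self _ (q / m), hqC]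
  have key (u : ℝ) : coneFun n S a z (glue (u + q / m) μ m)
      = (Set.Ioi (0 : ℝ)).indicator (fun u : ℝ => ((m ^ a : ℝ) : ℂ) *
        Complex.exp (2 * Real.pi * Complex.I * (m * vfirst z)) *
        Complex.exp (-(w / m * q)
          + -(2 * Real.pi * Complex.I) * bilin ℂ S (fun i => (μ i : ℂ)) (vmid z)) *
        ((u : ℂ) ^ ((a + 1 - 1 : ℝ) : ℂ) * Complex.exp (-(w * u)))) u := by
    have hQ : quadF ℝ (MatS0 n S) (glue (u + q / m) μ m) = u * m := by
      rw [quadF_MatS0, vfirst_glue, vlast_glue, vmid_glue, ← hq]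
      field_simp
      ring
    by_cases hu : 0 < u
    · have hmem : glue (u + q / m) μ m ∈ PosCone n S := by
        refine ⟨by rw [hQ]; positivity, ?_⟩
        change 0 < vfirst (glue (u + q / m) μ m)
        rw [vfirst_glue]
        positivity
      have hcast : (fun i => ((glue (u + q / m) μ m i : ℝ) : ℂ))
          = glue ((u + q / m : ℝ) : ℂ) (fun i => (μ i : ℂ)) (m : ℂ) := by
        refine funext (forall_iff_first_mid_last.mpr ⟨?_, fun i => ?_, ?_⟩)
        · exact (congrArg Complex.ofReal (vfirst_glue _ μ m)).trans (vfirst_glue _ _ _).symm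
        · exact (congrArg Complex.ofReal (congrFun (vmid_glue _ μ m) i)).trans
            (congrFun (vmid_glue ((u + q / m : ℝ) : ℂ) (fun i => (μ i : ℂ)) (m : ℂ)) i).symm
        · exact (congrArg Complex.ofReal (vlast_glue _ μ m)).trans (vlast_glue _ _ _).symm
      rw [coneFun, Set.indicator_of_mem hmem, Set.indicator_of_mem (Set.mem_Ioi.mpr hu), hQ, hcast,
        bilin_MatS0, vfirst_glue, vlast_glue, vmid_glue, add_sub_cancel_right,
        ← Complex.ofReal_cpow hu.le, Real.mul_rpow hu.le hm.le]
      have : Complex.exp (2 * Real.pi * Complex.I * (((u + q / m : ℝ) : ℂ) * vlast z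
            + (m : ℂ) * vfirst z - bilin ℂ S (fun i => (μ i : ℂ)) (vmid z)))
          = Complex.exp (2 * Real.pi * Complex.I * (m * vfirst z)) *
            Complex.exp (-(w / m * q)
              + -(2 * Real.pi * Complex.I) * bilin ℂ S (fun i => (μ i : ℂ)) (vmid z)) *
            Complex.exp (-(w * u)) := by
        rw [← Complex.exp_add, ← Complex.exp_add]
        congr 1
        push_cast
        rw [hw]
        ring
      rw [this]
      push_cast
      ring
    · have hmem : glue (u + q / m) μ m ∉ PosCone n S := by
        rintro ⟨h1, -⟩
        rw [hQ] at h1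
        exact hu (pos_of_mul_pos_left h1 hm.le)
      rw [coneFun, Set.indicator_of_notMem hmem, Set.indicator_of_notMem (by simpa using hu)]
  simp_rw [key]
  rw [integral_indicator measurableSet_Ioi, integral_const_mul,
    integral_cpow_mul_cexp_neg_mul_Ioi_of_re_pos (by linarith) hwre]
  ring

theorem integral_coneFun (hsymm : S.IsSymm)
    (hpos : ∀ v : Fin n → ℝ, v ≠ 0 → 0 < bilin ℝ S v v) {k : ℕ} (hk : n + 2 < k)
    {z : Fin (n + 2) → ℂ} (hz : z ∈ HS n S)
    (hFint : Integrable (coneFun n S ((k : ℝ) - (n + 2) / 2) z)) :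
    ∫ v, coneFun n S ((k : ℝ) - (n + 2) / 2) z v
      = (((2 * Real.pi) ^ ((n : ℝ) / 2) * Real.Gamma k * Real.Gamma ((k : ℝ) - n / 2)
          / Real.sqrt ((S.det : ℤ) : ℝ) : ℝ) : ℂ)
        * ((-(4 * Real.pi ^ 2 * quadF ℂ (MatS0 n S) z)) ^ k)⁻¹ := by
  set a : ℝ := (k : ℝ) - (n + 2) / 2 with ha
  have hkr : (n : ℝ) + 2 < k := by exact_mod_cast hk
  have ha0 : 0 < a := by
    have : (0 : ℝ) ≤ n := n.cast_nonneg
    rw [ha]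
    linarith
  set w : ℂ := -(2 * Real.pi * Complex.I * vlast z) with hw
  have hwre : 0 < w.re := by
    have : 0 < (vlast z).im := vlast_pos_of_mem hpos hz
    have h2 : w.re = 2 * Real.pi * (vlast z).im := by
      simp [hw, mul_assoc]
    rw [h2]
    positivity
  have hw0 : w ≠ 0 := by
    intro h
    rw [h] at hwre
    simp at hwre
  have hvl : vlast z ≠ 0 := by
    intro h
    apply hw0
    rw [hw, h, mul_zero, neg_zero]
  set w₂ : ℂ := -(2 * Real.pi * Complex.I * (vfirst z - quadF ℂ S (vmid z) / vlast z)) with hw₂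
  have hw₂re : 0 < w₂.re := by
    have := im_vfirst_sub_pos hsymm hpos hz
    have h2 : w₂.re = 2 * Real.pi * (vfirst z - quadF ℂ S (vmid z) / vlast z).im := by
      simp [hw₂, mul_assoc]
      ring
    rw [h2]
    positivity
  have hprod : w * w₂ = -(4 * Real.pi ^ 2 * quadF ℂ (MatS0 n S) z) := by
    rw [hw, hw₂, quadF_MatS0]
    field_simp
    rw [Complex.I_sq]
    ring
  rw [integral_eq_integral_glue hFint]
  have hsec (m : ℝ) : ∫ μ : Fin n → ℝ, ∫ l : ℝ, coneFun n S a z (glue l μ m)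
      = (Set.Ioi (0 : ℝ)).indicator (fun m : ℝ =>
        ((((2 * Real.pi) ^ ((n : ℝ) / 2) * Real.Gamma ((k : ℝ) - n / 2)
          / Real.sqrt ((S.det : ℤ) : ℝ) : ℝ) : ℂ) * (w ^ k)⁻¹) *
        ((m : ℂ) ^ (((k : ℝ) - 1 : ℝ) : ℂ) * Complex.exp (-(w₂ * m)))) m := by
    by_cases hm : 0 < m
    · rw [Set.indicator_of_mem (Set.mem_Ioi.mpr hm)]
      simp_rw [integral_coneFun_first hpos ha0 hz hm]
      have hmC : (m : ℂ) ≠ 0 := Complex.ofReal_ne_zero.mpr hm.ne'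
      have hwm : 0 < (w / m).re := by
        rw [Complex.div_ofReal_re]
        positivity
      rw [integral_const_mul, ← hw, integral_cexp_neg_mul_quadF_add hsymm hpos hwm]
      have hexp : Complex.exp (2 * Real.pi * Complex.I * (m * vfirst z)) *
          Complex.exp ((-(2 * Real.pi * Complex.I)) ^ 2 / (w / m) * quadF ℂ S (vmid z))
          = Complex.exp (-(w₂ * m)) := by
        rw [← Complex.exp_add]
        congr 1
        rw [hw₂, hw]
        field_simp
        ring
      have hpow : (2 * Real.pi / (w / m) : ℂ) ^ (n / 2 : ℂ)
          = (((2 * Real.pi) ^ ((n : ℝ) / 2) : ℝ) : ℂ) * ((m ^ ((n : ℝ) / 2) : ℝ) : ℂ)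
            * w ^ (-(n / 2 : ℂ)) := by
        have h1 : (2 * Real.pi / (w / m) : ℂ) = ((2 * Real.pi : ℝ) : ℂ) * ((m : ℝ) : ℂ) * w⁻¹ := by
          push_cast
          field_simp
        have hargw : w.arg ≠ Real.pi := by
          intro h
          have := Complex.arg_eq_pi_iff.mp h
          linarith
        rw [h1, ← Complex.ofReal_mul, ofReal_mul_cpow (by positivity) (inv_ne_zero hw0),
          Complex.inv_cpow _ _ hargw, Complex.cpow_neg, ← Complex.ofReal_mul,
          ← Real.mul_rpow (by positivity) hm.le, Complex.ofReal_cpow (by positivity)]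
        push_cast
        rfl
      have hwpow : w ^ (-((a + 1 : ℝ) : ℂ)) * w ^ (-(n / 2 : ℂ)) = (w ^ k)⁻¹ := by
        rw [← Complex.cpow_add _ _ hw0, ← Complex.cpow_natCast, ← Complex.cpow_neg]
        congr 1
        rw [ha]
        push_cast
        ring
      have hmpow : ((m ^ a : ℝ) : ℂ) * ((m ^ ((n : ℝ) / 2) : ℝ) : ℂ)
          = (m : ℂ) ^ (((k : ℝ) - 1 : ℝ) : ℂ) := by
        rw [← Complex.ofReal_mul, ← Real.rpow_add hm, ← Complex.ofReal_cpow hm.le]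
        congr 2
        rw [ha]
        ring
      have hG : a + 1 = (k : ℝ) - n / 2 := by
        rw [ha]
        ring
      rw [hpow, ← hexp, ← hmpow, ← hwpow, Complex.Gamma_ofReal, ← hG]
      push_cast
      ring
    · rw [Set.indicator_of_notMem (by simpa using hm)]
      have (μ : Fin n → ℝ) (l : ℝ) : coneFun n S a z (glue l μ m) = 0 := by
        refine Set.indicator_of_notMem (fun h => hm ?_) _
        have := vlast_pos_of_mem hpos h
        rwa [vlast_glue] at this
      simp [this]
  simp_rw [hsec]
  have hk0 : (0 : ℝ) < k := by
    have : (0 : ℝ) ≤ n := n.cast_nonneg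
    linarith
  rw [integral_indicator measurableSet_Ioi, integral_const_mul,
    integral_cpow_mul_cexp_neg_mul_Ioi_of_re_pos hk0 hw₂re, ← hprod, mul_pow,
    Complex.Gamma_ofReal, Complex.cpow_neg, Complex.ofReal_natCast, Complex.cpow_natCast]
  push_cast
  rw [mul_inv]
  ring

end OEis

namespace OEis

open MeasureTheory

theorem det_hyp {m : ℕ} (A : Matrix (Fin m) (Fin m) ℤ) : (hyp A).det = -A.det := by
  rw [Matrix.det_succ_row_zero, Fintype.sum_eq_single (Fin.last (m + 1))]
  swap
  · intro j hj
    have : hyp A 0 j = 0 := by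
      have : (j : ℕ) ≠ m + 1 := fun h => hj (Fin.ext h)
      simp [hyp, this]
    rw [this, mul_zero, zero_mul]
  rw [Matrix.det_succ_column_zero, Fintype.sum_eq_single (Fin.last m)]
  swap
  · intro i hi
    have : (hyp A).submatrix Fin.succ (Fin.last (m + 1)).succAbove i 0 = 0 := by
      have : (i : ℕ) ≠ m := fun h => hi (Fin.ext h)
      simp [hyp, this]
    rw [this, mul_zero, zero_mul]
  have h1 : hyp A 0 (Fin.last (m + 1)) = 1 := hyp_first_last A
  have h2 : (hyp A).submatrix Fin.succ (Fin.last (m + 1)).succAbove (Fin.last m) 0 = 1 := by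
    simp [hyp]
  have h3 : ((hyp A).submatrix Fin.succ (Fin.last (m + 1)).succAbove).submatrix
      (Fin.last m).succAbove Fin.succ = A := by
    ext i j
    simp only [Matrix.submatrix_apply, Fin.succAbove_last]
    exact hyp_mid_mid A i j
  rw [h1, h2, h3, Fin.val_last, Fin.val_last]
  have h4 : (-1 : ℤ) ^ (m + 1) * (-1) ^ m = -1 := by
    rw [pow_succ, mul_right_comm, ← mul_pow]
    simp
  linear_combination A.det * h4

variable {n : ℕ} {S : Matrix (Fin n) (Fin n) ℤ}

theorem abs_det_map_MatS0 (hsymm : S.IsSymm)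
    (hpos : ∀ v : Fin n → ℝ, v ≠ 0 → 0 < bilin ℝ S v v) :
    |((MatS0 n S).map (Int.cast : ℤ → ℝ)).det| = ((S.det : ℤ) : ℝ) := by
  rw [det_map_intCast, MatS0, det_hyp, Matrix.det_neg]
  rw [Int.cast_neg, Int.cast_mul, Int.cast_pow, Int.cast_neg, Int.cast_one, abs_neg, abs_mul, abs_pow, abs_neg, abs_one, one_pow, one_mul,
    abs_of_pos (det_pos hsymm hpos)]

/-- The elements of the dual lattice of `S₀` that lie in the positive cone. -/
abbrev DualCone (n : ℕ) (S : Matrix (Fin n) (Fin n) ℤ) : Type :=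
  {lam : Fin (n + 2) → ℚ //
    inDual (MatS0 n S) lam ∧ (fun i => ((lam i : ℚ) : ℝ)) ∈ PosCone n S}

theorem map_mulVec_ratCast {m : ℕ} (A : Matrix (Fin m) (Fin m) ℤ) (v : Fin m → ℚ) (i : Fin m) :
    (A.map (Int.cast : ℤ → ℝ)).mulVec (fun j => ((v j : ℚ) : ℝ)) i
      = (((A.map (Int.cast : ℤ → ℚ)).mulVec v i : ℚ) : ℝ) := by
  simp [Matrix.mulVec, dotProduct]

theorem norm_mulVec_le {m : ℕ} (A : Matrix (Fin m) (Fin m) ℝ) (v : Fin m → ℝ) :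
    ‖A.mulVec v‖ ≤ (∑ i, ∑ j, |A i j|) * ‖v‖ := by
  refine (pi_norm_le_iff_of_nonneg (by positivity)).mpr fun i => ?_
  rw [Matrix.mulVec, dotProduct]
  calc ‖∑ j, A i j * v j‖ ≤ ∑ j, ‖A i j * v j‖ := norm_sum_le _ _
    _ ≤ ∑ j, |A i j| * ‖v‖ := by
      gcongr with j
      rw [norm_mul]
      gcongr
      · rfl
      · exact norm_le_pi_norm v j
    _ = (∑ j, |A i j|) * ‖v‖ := by rw [Finset.sum_mul]
    _ ≤ _ := mul_le_mul_of_nonneg_right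
      (Finset.single_le_sum (f := fun i => ∑ j, |A i j|) (fun i _ => by positivity)
        (Finset.mem_univ i)) (norm_nonneg v)

/-- The cone function in the coordinates `η = S₀v`. -/
noncomputable def dualConeFun (n : ℕ) (S : Matrix (Fin n) (Fin n) ℤ) (a : ℝ)
    (z : Fin (n + 2) → ℂ) (η : Fin (n + 2) → ℝ) : ℂ :=
  coneFun n S a z (((MatS0 n S).map (Int.cast : ℤ → ℝ))⁻¹.mulVec η)

/-- The integral coordinates `S₀λ` of an element of the dual lattice. -/
def DualCone.coord (lam : DualCone n S) (i : Fin (n + 2)) : ℤ :=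
  (((MatS0 n S).map (Int.cast : ℤ → ℚ)).mulVec lam.1 i).num

theorem DualCone.coord_cast (lam : DualCone n S) (i : Fin (n + 2)) :
    ((lam.coord i : ℤ) : ℚ) = ((MatS0 n S).map (Int.cast : ℤ → ℚ)).mulVec lam.1 i := by
  obtain ⟨x, hx⟩ := lam.2.1 i
  rw [coord, hx, Rat.num_intCast]

variable (hsymm : S.IsSymm) (hpos : ∀ v : Fin n → ℝ, v ≠ 0 → 0 < bilin ℝ S v v)
include hsymm hpos

theorem det_map_MatS0_ne_zero : ((MatS0 n S).map (Int.cast : ℤ → ℝ)).det ≠ 0 := by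
  rw [← abs_pos, abs_det_map_MatS0 hsymm hpos]
  exact det_pos hsymm hpos

theorem det_map_MatS0_rat_ne_zero : ((MatS0 n S).map (Int.cast : ℤ → ℚ)).det ≠ 0 := by
  have h := det_map_MatS0_ne_zero hsymm hpos
  rw [det_map_intCast] at h
  have h2 : ((MatS0 n S).map (Int.cast : ℤ → ℚ)).det = (((MatS0 n S).det : ℤ) : ℚ) :=
    ((Int.castRingHom ℚ).map_det (MatS0 n S)).symm
  rw [h2]
  exact_mod_cast h

theorem inv_mulVec_coord (lam : DualCone n S) :
    ((MatS0 n S).map (Int.cast : ℤ → ℝ))⁻¹.mulVec (fun i => (lam.coord i : ℝ))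
      = fun i => ((lam.1 i : ℚ) : ℝ) := by
  have h : (fun i => (lam.coord i : ℝ))
      = ((MatS0 n S).map (Int.cast : ℤ → ℝ)).mulVec (fun i => ((lam.1 i : ℚ) : ℝ)) := by
    ext i
    rw [map_mulVec_ratCast, ← lam.coord_cast, Rat.cast_intCast]
  rw [h, Matrix.mulVec_mulVec, Matrix.nonsing_inv_mul _
    (det_map_MatS0_ne_zero hsymm hpos).isUnit, Matrix.one_mulVec]

theorem dualConeFun_coord (a : ℝ) (z : Fin (n + 2) → ℂ) (lam : DualCone n S) :
    dualConeFun n S a z (fun i => (lam.coord i : ℝ))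
      = coneFun n S a z (fun i => ((lam.1 i : ℚ) : ℝ)) := by
  rw [dualConeFun, inv_mulVec_coord hsymm hpos]

theorem coord_injective : Function.Injective (DualCone.coord (n := n) (S := S)) := by
  intro l l' h
  have h1 := inv_mulVec_coord hsymm hpos l
  rw [h, inv_mulVec_coord hsymm hpos l'] at h1
  refine Subtype.ext (funext fun i => ?_)
  exact_mod_cast (congrFun h1 i).symm

theorem support_subset_range_coord (a : ℝ) (z : Fin (n + 2) → ℂ) :
    Function.support (fun η : Fin (n + 2) → ℤ => dualConeFun n S a z (fun i => (η i : ℝ)))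
      ⊆ Set.range (DualCone.coord (n := n) (S := S)) := by
  intro η hη
  rw [Function.mem_support, dualConeFun, coneFun] at hη
  have hmem := Set.mem_of_indicator_ne_zero hη
  set lam := ((MatS0 n S).map (Int.cast : ℤ → ℚ))⁻¹.mulVec (fun i => (η i : ℚ)) with hlam
  have h1 : ((MatS0 n S).map (Int.cast : ℤ → ℚ)).mulVec lam = fun i => (η i : ℚ) := by
    rw [hlam, Matrix.mulVec_mulVec, Matrix.mul_nonsing_inv _
      (det_map_MatS0_rat_ne_zero hsymm hpos).isUnit, Matrix.one_mulVec]
  have h2 : ((MatS0 n S).map (Int.cast : ℤ → ℝ))⁻¹.mulVec (fun i => (η i : ℝ))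
      = fun i => ((lam i : ℚ) : ℝ) := by
    have h : (fun i => (η i : ℝ))
        = ((MatS0 n S).map (Int.cast : ℤ → ℝ)).mulVec (fun i => ((lam i : ℚ) : ℝ)) := by
      ext i
      rw [map_mulVec_ratCast, h1, Rat.cast_intCast]
    rw [h, Matrix.mulVec_mulVec, Matrix.nonsing_inv_mul _
      (det_map_MatS0_ne_zero hsymm hpos).isUnit, Matrix.one_mulVec]
  rw [h2] at hmem
  refine ⟨⟨lam, fun i => ⟨η i, congrFun h1 i⟩, hmem⟩, funext fun i => ?_⟩
  rw [DualCone.coord, h1, Rat.num_intCast]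

theorem exists_norm_dualConeFun_le {a : ℝ} (ha : 0 ≤ a) {z : Fin (n + 2) → ℂ}
    (hz : z ∈ HS n S) (r : ℕ) :
    ∃ C : ℝ, 0 ≤ C ∧ ∀ η, ‖dualConeFun n S a z η‖ ≤ C * ((1 + ‖η‖) ^ r)⁻¹ := by
  obtain ⟨C, hC, h⟩ := exists_norm_coneFun_le hsymm hpos ha hz r
  set M : ℝ := ∑ i, ∑ j, |((MatS0 n S).map (Int.cast : ℤ → ℝ)) i j| with hM
  have hM0 : 0 ≤ M := by positivity
  refine ⟨C * (1 + M) ^ r, by positivity, fun η => (h _).trans ?_⟩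
  set v := ((MatS0 n S).map (Int.cast : ℤ → ℝ))⁻¹.mulVec η with hv
  have h1 : ‖η‖ ≤ M * ‖v‖ := by
    have h2 := norm_mulVec_le ((MatS0 n S).map (Int.cast : ℤ → ℝ)) v
    rwa [hv, Matrix.mulVec_mulVec, Matrix.mul_nonsing_inv _
      (det_map_MatS0_ne_zero hsymm hpos).isUnit, Matrix.one_mulVec] at h2
  have h3 : 1 + ‖η‖ ≤ (1 + M) * (1 + ‖v‖) := by nlinarith [norm_nonneg v]
  rw [mul_assoc]
  gcongr
  rw [← div_eq_mul_inv, le_div_iff₀ (by positivity), inv_mul_le_iff₀ (by positivity), ← mul_pow]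
  rw [mul_comm (1 + ‖v‖)]
  gcongr

theorem summable_norm_coneFun {a : ℝ} (ha : 0 ≤ a) {z : Fin (n + 2) → ℂ} (hz : z ∈ HS n S) :
    Summable fun lam : DualCone n S => ‖coneFun n S a z (fun i => ((lam.1 i : ℚ) : ℝ))‖ := by
  obtain ⟨C, hC, h⟩ := exists_norm_dualConeFun_le hsymm hpos ha hz (n + 3)
  have hs : Summable fun η : Fin (n + 2) → ℤ => C * ((1 + ‖fun i => (η i : ℝ)‖) ^ (n + 3))⁻¹ :=
    (summable_inv_one_add_norm_pow (by simp)).mul_left C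
  refine Summable.of_nonneg_of_le (fun _ => norm_nonneg _) (fun lam => ?_)
    (hs.comp_injective (coord_injective hsymm hpos))
  rw [← dualConeFun_coord hsymm hpos]
  exact h _

theorem exists_norm_quadF_zpow_le {z : Fin (n + 2) → ℂ} (hz : z ∈ HS n S) (k : ℕ) :
    ∃ C : ℝ, 0 ≤ C ∧ ∀ x : Fin (n + 2) → ℝ,
      ‖quadF ℂ (MatS0 n S) (fun i => z i + x i) ^ (-(k : ℤ))‖ ≤ C * ((1 + ‖x‖) ^ k)⁻¹ := by
  obtain ⟨c, hc, h⟩ := exists_pos_mul_le_norm_quadF hsymm hpos hz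
  refine ⟨(c ^ k)⁻¹, by positivity, fun x => ?_⟩
  rw [_root_.zpow_neg, zpow_natCast, norm_inv, norm_pow, ← mul_inv, ← mul_pow]
  gcongr
  exact h x

omit hsymm hpos in
theorem add_ofReal_mem_HS {z : Fin (n + 2) → ℂ} (hz : z ∈ HS n S) (x : Fin (n + 2) → ℝ) :
    (fun i => z i + x i) ∈ HS n S := by
  simpa [HS] using hz

omit hsymm hpos in
theorem coneFun_add (a : ℝ) (z w : Fin (n + 2) → ℂ) (v : Fin (n + 2) → ℝ) :
    coneFun n S a (fun i => z i + w i) v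
      = Complex.exp (2 * Real.pi * Complex.I * bilin ℂ (MatS0 n S) (fun i => (v i : ℂ)) w)
        * coneFun n S a z v := by
  by_cases hv : v ∈ PosCone n S
  · rw [coneFun, coneFun, Set.indicator_of_mem hv, Set.indicator_of_mem hv]
    change _ * Complex.exp (_ * bilin ℂ (MatS0 n S) _ (z + w)) = _
    rw [bilin_add_right, mul_add, Complex.exp_add]
    ring
  · rw [coneFun, coneFun, Set.indicator_of_notMem hv, Set.indicator_of_notMem hv, mul_zero]

theorem tsum_quadF_zpow_eq {k : ℕ} (hk : n + 2 < k) (hke : Even k)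
    {z : Fin (n + 2) → ℂ} (hz : z ∈ HS n S) :
    ∑' m : Fin (n + 2) → ℤ, quadF ℂ (MatS0 n S) (fun i => z i + m i) ^ (-(k : ℤ))
      = (ckS n S k : ℂ) * ∑' lam : DualCone n S,
        coneFun n S ((k : ℝ) - (n + 2) / 2) z (fun i => ((lam.1 i : ℚ) : ℝ)) := by
  set a : ℝ := (k : ℝ) - (n + 2) / 2 with ha
  have hkr : (n : ℝ) + 2 < k := by exact_mod_cast hk
  have hn0 : (0 : ℝ) ≤ n := n.cast_nonneg
  have ha0 : 0 < a := by
    rw [ha]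
    linarith
  have hdet0 := det_map_MatS0_ne_zero hsymm hpos
  set T := (MatS0 n S).map (Int.cast : ℤ → ℝ) with hT
  set D : ℝ := ((S.det : ℤ) : ℝ) with hD
  have hD0 : 0 < D := det_pos hsymm hpos
  set C₁ : ℝ := (2 * Real.pi) ^ ((n : ℝ) / 2) * Real.Gamma k * Real.Gamma ((k : ℝ) - n / 2)
          / Real.sqrt D with hC₁
  have hcont : Continuous (dualConeFun n S a z) :=
    (continuous_coneFun hpos ha0 z).comp (Continuous.matrix_mulVec continuous_const continuous_id)
  have hFint (m : Fin (n + 2) → ℤ) :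
      ∫ x : Fin (n + 2) → ℝ, Complex.exp (2 * Real.pi * Complex.I * ∑ i, (m i : ℂ) * x i)
        * dualConeFun n S a z x
      = ((D * C₁ / (2 * Real.pi) ^ (2 * k) : ℝ) : ℂ) *
        quadF ℂ (MatS0 n S) (fun i => z i + m i) ^ (-(k : ℤ)) := by
    have hzm : (fun i => z i + m i) ∈ HS n S := by
      simpa using add_ofReal_mem_HS hz (fun i => (m i : ℝ))
    have h1 := integral_comp_mulVec hdet0 (fun x : Fin (n + 2) → ℝ =>
      Complex.exp (2 * Real.pi * Complex.I * ∑ i, (m i : ℂ) * x i) * dualConeFun n S a z x)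
    rw [abs_det_map_MatS0 hsymm hpos, ← hD, eq_inv_smul_iff₀ hD0.ne'] at h1
    rw [← h1]
    have h2 (v : Fin (n + 2) → ℝ) :
        Complex.exp (2 * Real.pi * Complex.I * ∑ i, (m i : ℂ) * (T.mulVec v i : ℝ))
          * dualConeFun n S a z (T.mulVec v) = coneFun n S a (fun i => z i + m i) v := by
      rw [coneFun_add, dualConeFun, Matrix.mulVec_mulVec, Matrix.nonsing_inv_mul _ hdet0.isUnit,
        Matrix.one_mulVec, bilin_comm (isSymm_MatS0 hsymm)]
      congr 3
      simp [bilin, dotProduct, Matrix.mulVec, hT]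
    simp_rw [h2]
    have hi : Integrable (coneFun n S a (fun i => z i + m i)) := by
      obtain ⟨C, hC, hb⟩ := exists_norm_coneFun_le hsymm hpos ha0.le hzm (n + 3)
      have hdom : Integrable fun x : Fin (n + 2) → ℝ => C * (1 + ‖x‖) ^ (-((n + 3 : ℕ) : ℝ)) :=
        (integrable_one_add_norm (by simp; norm_num)).const_mul C
      refine hdom.mono' (continuous_coneFun hpos ha0 _).aestronglyMeasurable
        (Filter.Eventually.of_forall fun x => ?_)
      rw [Real.rpow_neg (by positivity), Real.rpow_natCast]
      exact hb x
    rw [integral_coneFun hsymm hpos hk hzm hi, ← hD, ← hC₁, Complex.real_smul, hke.neg_pow,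
      mul_pow, mul_inv, _root_.zpow_neg, zpow_natCast]
    have h4 : (4 * Real.pi ^ 2 : ℂ) ^ k = (2 * Real.pi) ^ (2 * k) := by
      rw [pow_mul]
      congr 1
      ring
    rw [h4]
    push_cast
    ring
  obtain ⟨C, hC, hb⟩ := exists_norm_dualConeFun_le hsymm hpos ha0.le hz (n + 3)
  obtain ⟨C', hC', hb'⟩ := exists_norm_quadF_zpow_le hsymm hpos hz k
  have hsum : Summable fun m : Fin (n + 2) → ℤ =>
      quadF ℂ (MatS0 n S) (fun i => z i + m i) ^ (-(k : ℤ)) := by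
    refine Summable.of_norm_bounded
      (g := fun m : Fin (n + 2) → ℤ => C' * ((1 + ‖fun i => (m i : ℝ)‖) ^ k)⁻¹)
      ((summable_inv_one_add_norm_pow (by simpa using hk)).mul_left C') fun m => ?_
    simpa using hb' (fun i => (m i : ℝ))
  have hP := tsum_eq_tsum_integral_of_decay hcont (r := n + 3) (by simp) hb
    (by simpa only [hFint] using hsum.mul_left _)
  simp_rw [hFint] at hP
  rw [tsum_mul_left, ← (coord_injective hsymm hpos).tsum_eq
    (support_subset_range_coord hsymm hpos a z)] at hP
  simp_rw [dualConeFun_coord hsymm hpos] at hP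
  rw [hP, ← mul_assoc, ← Complex.ofReal_mul]
  have hconst : ckS n S k * (D * C₁ / (2 * Real.pi) ^ (2 * k)) = 1 := by
    have hG1 : 0 < Real.Gamma (k : ℝ) := Real.Gamma_pos_of_pos (by linarith)
    have hG2 : 0 < Real.Gamma ((k : ℝ) - n / 2) := Real.Gamma_pos_of_pos (by linarith)
    have hsD : 0 < Real.sqrt D := Real.sqrt_pos.mpr hD0
    have hpi : (0 : ℝ) < 2 * Real.pi := by positivity
    have hpw : (2 * Real.pi) ^ ((2 * k : ℝ) - n / 2) * (2 * Real.pi) ^ ((n : ℝ) / 2)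
        = (2 * Real.pi) ^ (2 * k) := by
      rw [← Real.rpow_add hpi, sub_add_cancel, ← Real.rpow_natCast]
      push_cast
      rfl
    have hDD : D = Real.sqrt D * Real.sqrt D := (Real.mul_self_sqrt hD0.le).symm
    rw [ckS, ← hD, hC₁, ← hpw]
    generalize Real.Gamma ((k : ℝ) - n / 2) = G at hG2
    have h5 : (2 * Real.pi) ^ ((2 * k : ℝ) - n / 2) ≠ 0 := (Real.rpow_pos_of_pos hpi _).ne'
    have h6 : (2 * Real.pi) ^ ((n : ℝ) / 2) ≠ 0 := (Real.rpow_pos_of_pos hpi _).ne'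
    field_simp
    rw [Real.sq_sqrt hD0.le]
  rw [hconst, Complex.ofReal_one, one_mul]

end OEis

namespace OEis

theorem card_filter_dvd_mul_sub_le_gcd {G : ℕ} (hG : 0 < G) (a t : ℤ) :
    ((Finset.Ico (0 : ℤ) G).filter fun x => (G : ℤ) ∣ a * x - t).card ≤ Int.gcd G a := by
  have hg0 : 0 < Int.gcd G a := Int.gcd_pos_of_ne_zero_left _ (by exact_mod_cast hG.ne')
  obtain ⟨q, hq⟩ : ((Int.gcd G a : ℕ) : ℤ) ∣ G := Int.gcd_dvd_left ..
  have hg1 : (0 : ℤ) < Int.gcd G a := by exact_mod_cast hg0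
  have hG1 : (0 : ℤ) < G := by exact_mod_cast hG
  have hq0 : 0 < q := by
    rw [hq] at hG1
    exact pos_of_mul_pos_right hG1 hg1.le
  have hGq : (G : ℤ) / (Int.gcd G a : ℕ) = q := by
    nth_rw 1 [hq]
    exact Int.mul_ediv_cancel_left _ hg1.ne'
  calc _ ≤ (Finset.Ico (0 : ℤ) (Int.gcd G a : ℕ)).card := by
        refine Finset.card_le_card_of_injOn (fun x => x / q) (fun x hx => ?_) fun x hx y hy h => ?_
        · simp only [Finset.coe_filter, Finset.mem_Ico, Set.mem_ofPred_eq] at hx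
          simp only [Finset.coe_Ico, Set.mem_Ico]
          refine ⟨Int.ediv_nonneg hx.1.1 hq0.le, Int.ediv_lt_of_lt_mul hq0 ?_⟩
          rw [← hq]
          exact hx.1.2
        · simp only [Finset.coe_filter, Finset.mem_Ico, Set.mem_ofPred_eq] at hx hy h
          have hmod : a * x ≡ a * y [ZMOD G] := by
            refine Int.modEq_iff_dvd.mpr ?_
            have := dvd_sub hy.2 hx.2
            rwa [sub_sub_sub_cancel_right] at this
          have hmod' := Int.ModEq.cancel_left_div_gcd hG1 hmod
          rw [hGq] at hmod'
          rw [← Int.mul_ediv_add_emod x q, ← Int.mul_ediv_add_emod y q, h, hmod']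
    _ = Int.gcd G a := by simp

theorem sum_gcd_le {G : ℕ} (hG : 0 < G) :
    ∑ a ∈ Finset.Ico (0 : ℤ) G, Int.gcd G a ≤ G * G.divisors.card := by
  classical
  calc ∑ a ∈ Finset.Ico (0 : ℤ) G, Int.gcd G a
      ≤ ∑ a ∈ Finset.Ico (0 : ℤ) G, ∑ d ∈ G.divisors, if (d : ℤ) ∣ a then d else 0 := by
        refine Finset.sum_le_sum fun a _ => ?_
        have hmem : Int.gcd G a ∈ G.divisors :=
          Nat.mem_divisors.mpr ⟨by exact_mod_cast Int.gcd_dvd_left (G : ℤ) a, hG.ne'⟩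
        refine le_trans (le_of_eq ?_)
          (Finset.single_le_sum (f := fun d : ℕ => if (d : ℤ) ∣ a then d else 0)
            (fun _ _ => Nat.zero_le _) hmem)
        rw [if_pos (Int.gcd_dvd_right ..)]
    _ = ∑ d ∈ G.divisors, ∑ a ∈ Finset.Ico (0 : ℤ) G, if (d : ℤ) ∣ a then d else 0 :=
        Finset.sum_comm
    _ ≤ ∑ d ∈ G.divisors, G := by
        refine Finset.sum_le_sum fun d hd => ?_
        obtain ⟨q, hq⟩ := Nat.dvd_of_mem_divisors hd
        have hq0 : 0 < q := Nat.pos_of_ne_zero fun h => by simp [h] at hq; omega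
        have hq1 : (q : ℤ) ≠ 0 := by exact_mod_cast hq0.ne'
        rw [← Finset.sum_filter, Finset.sum_const, smul_eq_mul]
        have h1 := card_filter_dvd_mul_sub_le_gcd hG q 0
        have h2 : Int.gcd G q = q := by
          rw [Int.gcd_natCast_natCast, hq, Nat.gcd_mul_left_left]
        have h3 (x : ℤ) : (G : ℤ) ∣ q * x - 0 ↔ (d : ℤ) ∣ x := by
          rw [sub_zero, hq, Nat.cast_mul, mul_comm (d : ℤ), mul_dvd_mul_iff_left hq1]
        simp_rw [h3, h2] at h1
        calc _ ≤ q * d := Nat.mul_le_mul_right _ h1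
          _ = G := by rw [hq, mul_comm]
    _ = G * G.divisors.card := by rw [Finset.sum_const, smul_eq_mul, mul_comm]

theorem card_divisors_le_two_mul_sqrt (G : ℕ) : G.divisors.card ≤ 2 * G.sqrt := by
  classical
  have hsub : G.divisors ⊆
      Finset.Icc 1 G.sqrt ∪ (Finset.Icc 1 G.sqrt).image fun d => G / d := by
    intro d hd
    obtain ⟨⟨e, he⟩, hG⟩ := Nat.mem_divisors.mp hd
    have hd0 : 0 < d := Nat.pos_of_mem_divisors hd
    have he0 : 0 < e := Nat.pos_of_ne_zero fun h => hG (by rw [he, h, mul_zero])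
    rw [Finset.mem_union, Finset.mem_image]
    rcases le_total d e with h | h
    · exact Or.inl (Finset.mem_Icc.mpr ⟨hd0, Nat.le_sqrt.mpr (he ▸ Nat.mul_le_mul_left d h)⟩)
    · refine Or.inr ⟨e, Finset.mem_Icc.mpr ⟨he0, Nat.le_sqrt.mpr
        (he ▸ Nat.mul_le_mul_right e h)⟩, ?_⟩
      rw [he, Nat.mul_div_cancel _ he0]
  calc G.divisors.card ≤ _ := Finset.card_le_card hsub
    _ ≤ _ := Finset.card_union_le _ _
    _ ≤ G.sqrt + G.sqrt := by
      refine add_le_add (by simp) (Finset.card_image_le.trans (by simp))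
    _ = 2 * G.sqrt := by ring

variable {n : ℕ} {S : Matrix (Fin n) (Fin n) ℤ} {c : Fin (n + 4) → ℚ}

theorem ext_first_mid_last {m : ℕ} {K : Type} {g g' : Fin (m + 2) → K}
    (h0 : vfirst g = vfirst g') (hm : vmid g = vmid g') (hl : vlast g = vlast g') : g = g' :=
  funext (forall_iff_first_mid_last.mpr ⟨h0, fun i => congrFun hm i, hl⟩)

theorem IsStdCusp.vfirst_eq (hc : IsStdCusp n S c) : vfirst c = 1 := by
  obtain ⟨fc, -, -, rfl⟩ := hc
  simp [vfirst, stdCuspVec]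

theorem IsStdCusp.exists_vlast_eq (hc : IsStdCusp n S c) : ∃ q : ℤ, vlast c = q := by
  obtain ⟨fc, -, ⟨q, hq⟩, rfl⟩ := hc
  exact ⟨q, by simp [vlast, stdCuspVec, hq]⟩

theorem IsStdCusp.vfirst_vmid (hc : IsStdCusp n S c) : vfirst (vmid c) = 0 := by
  obtain ⟨fc, -, -, rfl⟩ := hc
  simp [vfirst, vmid, stdCuspVec]

theorem IsStdCusp.vlast_vmid (hc : IsStdCusp n S c) : vlast (vmid c) = 0 := by
  obtain ⟨fc, -, -, rfl⟩ := hc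
  simp [vlast, vmid, stdCuspVec]

theorem IsStdCusp.inDual_vmid_vmid (hc : IsStdCusp n S c) : inDual S (vmid (vmid c)) := by
  obtain ⟨fc, h, -, rfl⟩ := hc
  convert h using 1
  ext i
  have h1 : (i : ℕ) ≠ n := i.isLt.ne
  have h2 : (i : ℕ) ≠ n + 1 := by have := i.isLt; omega
  simp [vmid, stdCuspVec, h1, h2]

theorem quadF_MatS1 (g : Fin (n + 4) → ℚ) :
    quadF ℚ (MatS1 n S) g = vfirst g * vlast g + quadF ℚ (MatS0 n S) (vmid g) := by
  rw [MatS1]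
  exact quadF_hyp _ g

/-- The integral vector `d + c̃` attached to an element of `Gset`. -/
def midNum (c g : Fin (n + 4) → ℚ) (i : Fin (n + 2)) : ℤ := (vmid g i + vmid c i).num

theorem midNum_cast {γ : ℤ} {g : Fin (n + 4) → ℚ} (hg : g ∈ Gset n S c γ) (i : Fin (n + 2)) :
    ((midNum c g i : ℤ) : ℚ) = vmid g i + vmid c i := by
  obtain ⟨x, hx⟩ := hg.1 ⟨(i : ℕ) + 1, by have := i.isLt; omega⟩
  have h : vmid g i + vmid c i = x := by rw [← hx, sub_neg_eq_add]; rfl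
  rw [midNum, h, Rat.num_intCast]

theorem midNum_mem {γ : ℤ} {g : Fin (n + 4) → ℚ} (hg : g ∈ Gset n S c γ) (i : Fin (n + 2)) :
    midNum c g i ∈ Finset.Ico (0 : ℤ) γ.natAbs := by
  have h := hg.2.2.2.2 i
  rw [← midNum_cast hg, ← Int.cast_abs] at h
  rw [Finset.mem_Ico, Int.natCast_natAbs]
  exact_mod_cast h

theorem Gset_injOn {γ : ℤ} (hγ : γ ≠ 0) : Set.InjOn (midNum c) (Gset n S c γ) := by
  intro g hg g' hg' h
  have hγ' : (γ : ℚ) ≠ 0 := by exact_mod_cast hγ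
  have hl : vlast g = vlast g' := hg.2.2.2.1.trans hg'.2.2.2.1.symm
  have hm : vmid g = vmid g' := by
    ext i
    have h1 := midNum_cast hg i
    rw [h, midNum_cast hg'] at h1
    exact (add_right_cancel h1).symm
  refine ext_first_mid_last ?_ hm hl
  have h1 := hg.2.1
  have h2 := hg'.2.1
  rw [quadF_MatS1, hg.2.2.2.1] at h1
  rw [quadF_MatS1, hg'.2.2.2.1, ← hm] at h2
  exact mul_right_cancel₀ hγ' (add_right_cancel (h1.trans h2.symm))

theorem dvd_vfirst_mul_vlast_midNum (hc : IsStdCusp n S c) {γ : ℤ} {g : Fin (n + 4) → ℚ}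
    (hg : g ∈ Gset n S c γ) :
    (γ.natAbs : ℤ) ∣ vfirst (midNum c g) * vlast (midNum c g)
      - (quadF ℚ S fun i => ((vmid (midNum c g) i : ℤ) : ℚ) - vmid (vmid c) i).num := by
  obtain ⟨x, hx⟩ := hg.1 ⟨0, by omega⟩
  have hδ : vfirst g = ((x - 1 : ℤ) : ℚ) := by
    have := hc.vfirst_eq
    rw [vfirst] at this
    simp only [this] at hx
    rw [vfirst]
    push_cast
    linarith
  have h0 : vfirst (vmid g) = ((vfirst (midNum c g) : ℤ) : ℚ) := by
    have h1 := midNum_cast hg ⟨0, by omega⟩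
    have h2 := hc.vfirst_vmid
    rw [vfirst] at h2
    rw [h2, add_zero] at h1
    exact h1.symm
  have hl : vlast (vmid g) = ((vlast (midNum c g) : ℤ) : ℚ) := by
    have h1 := midNum_cast hg ⟨n + 1, by omega⟩
    have h2 := hc.vlast_vmid
    rw [vlast] at h2
    rw [h2, add_zero] at h1
    exact h1.symm
  have hm : (fun i => ((vmid (midNum c g) i : ℤ) : ℚ) - vmid (vmid c) i) = vmid (vmid g) := by
    ext i
    have h1 := midNum_cast hg ⟨(i : ℕ) + 1, by have := i.isLt; omega⟩
    rw [vmid, h1]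
    simp [vmid]
  have h1 := hg.2.1
  rw [quadF_MatS1, quadF_MatS0, hg.2.2.2.1, hδ, h0, hl] at h1
  have h2 : quadF ℚ S (vmid (vmid g))
      = ((x - 1) * γ + vfirst (midNum c g) * vlast (midNum c g) : ℤ) := by
    push_cast at h1 ⊢
    linarith
  rw [hm, h2, Rat.num_intCast, Int.natAbs_dvd]
  exact ⟨-(x - 1), by ring⟩

theorem finite_Gset {γ : ℤ} (hγ : γ ≠ 0) : Finite (Gset n S c γ) := by
  refine Set.Finite.of_finite_image (f := midNum c) (Set.Finite.subset
    (Fintype.piFinset fun _ : Fin (n + 2) => Finset.Ico (0 : ℤ) γ.natAbs).finite_toSet ?_)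
    (Gset_injOn hγ)
  rintro _ ⟨g, hg, rfl⟩
  exact Finset.mem_coe.mpr (Fintype.mem_piFinset.mpr (midNum_mem hg))

theorem natCard_Gset_le (hc : IsStdCusp n S c) {γ : ℤ} (hγ : γ ≠ 0) :
    Nat.card (Gset n S c γ) ≤ γ.natAbs ^ (n + 1) * γ.natAbs.divisors.card := by
  classical
  set G := γ.natAbs with hGdef
  have hG : 0 < G := Int.natAbs_pos.mpr hγ
  set t : (Fin n → ℤ) → ℤ := fun e =>
    (quadF ℚ S fun i => ((e i : ℤ) : ℚ) - vmid (vmid c) i).num with ht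
  set I := Finset.Ico (0 : ℤ) G with hI
  set F := ((Fintype.piFinset fun _ : Fin n => I) ×ˢ I).sigma fun p =>
    I.filter fun x => (G : ℤ) ∣ p.2 * x - t p.1 with hF
  have hmem (g : Gset n S c γ) :
      (⟨(vmid (midNum c g.1), vfirst (midNum c g.1)), vlast (midNum c g.1)⟩ :
        Σ _ : (Fin n → ℤ) × ℤ, ℤ) ∈ F := by
    simp only [hF, Finset.mem_sigma, Finset.mem_product, Fintype.mem_piFinset, Finset.mem_filter]
    exact ⟨⟨fun i => midNum_mem g.2 _, midNum_mem g.2 _⟩, midNum_mem g.2 _,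
      dvd_vfirst_mul_vlast_midNum hc g.2⟩
  calc Nat.card (Gset n S c γ) ≤ Nat.card F := by
        refine Nat.card_le_card_of_injective (fun g => ⟨_, hmem g⟩) fun g g' h => ?_
        simp only [Subtype.mk.injEq, Sigma.mk.injEq, Prod.mk.injEq, heq_eq_eq] at h
        exact Subtype.ext (Gset_injOn hγ g.2 g'.2 (ext_first_mid_last h.1.2 h.1.1 h.2))
    _ = ∑ p ∈ (Fintype.piFinset fun _ : Fin n => I) ×ˢ I,
        (I.filter fun x => (G : ℤ) ∣ p.2 * x - t p.1).card := by
      rw [Nat.card_eq_fintype_card, Fintype.card_coe, hF, Finset.card_sigma]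
    _ ≤ ∑ p ∈ (Fintype.piFinset fun _ : Fin n => I) ×ˢ I, Int.gcd G p.2 :=
      Finset.sum_le_sum fun p _ => card_filter_dvd_mul_sub_le_gcd hG _ _
    _ = G ^ n * ∑ a ∈ I, Int.gcd G a := by
      rw [Finset.sum_product]
      simp only [Finset.sum_const, Fintype.card_piFinset]
      simp [hI]
    _ ≤ G ^ n * (G * G.divisors.card) := Nat.mul_le_mul_left _ (sum_gcd_le hG)
    _ = G ^ (n + 1) * G.divisors.card := by ring

theorem summable_sigma_Gset (hc : IsStdCusp n S c) {k : ℕ} (hk : n + 2 < k) :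
    Summable fun x : Σ γ : {γ : ℤ // γ ≠ 0}, Gset n S c γ.1 => ‖((x.1.1 : ℂ)) ^ (-(k : ℤ))‖ := by
  rw [summable_sigma_of_nonneg fun _ => norm_nonneg _]
  have hfin (γ : {γ : ℤ // γ ≠ 0}) : Finite (Gset n S c γ.1) := finite_Gset γ.2
  refine ⟨fun γ => Summable.of_finite, ?_⟩
  have hs : Summable fun γ : {γ : ℤ // γ ≠ 0} => 2 * |((γ.1 : ℤ) : ℝ)| ^ (-(3 / 2 : ℝ)) :=
    ((Real.summable_abs_int_rpow (by norm_num)).comp_injective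
      Subtype.val_injective).mul_left 2
  refine Summable.of_nonneg_of_le (fun γ => tsum_nonneg fun _ => norm_nonneg _) (fun γ => ?_) hs
  simp only [tsum_const, nsmul_eq_mul]
  set G := γ.1.natAbs with hG
  have hG0 : 0 < G := Int.natAbs_pos.mpr γ.2
  have hG1 : (1 : ℝ) ≤ G := by exact_mod_cast hG0
  have hGabs : |((γ.1 : ℤ) : ℝ)| = G := by rw [hG, Nat.cast_natAbs, Int.cast_abs]
  have hcard : (Nat.card (Gset n S c γ.1) : ℝ) ≤ (G : ℝ) ^ (n + 1) * (2 * (G : ℝ) ^ (1 / 2 : ℝ)) := by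
    calc (Nat.card (Gset n S c γ.1) : ℝ) ≤ ((G ^ (n + 1) * (2 * G.sqrt) : ℕ) : ℝ) := by
          exact_mod_cast (natCard_Gset_le hc γ.2).trans
            (Nat.mul_le_mul_left _ (card_divisors_le_two_mul_sqrt G))
      _ ≤ _ := by
        push_cast
        gcongr
        rw [← Real.sqrt_eq_rpow]
        exact Real.nat_sqrt_le_real_sqrt
  have hnorm : ‖((γ.1 : ℤ) : ℂ) ^ (-(k : ℤ))‖ ≤ (G : ℝ) ^ (-((n + 3 : ℕ) : ℝ)) := by
    rw [norm_zpow, Complex.norm_intCast, hGabs, _root_.zpow_neg, zpow_natCast, Real.rpow_neg (by positivity),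
      Real.rpow_natCast]
    gcongr
    exact hk
  calc _ ≤ ((G : ℝ) ^ (n + 1) * (2 * (G : ℝ) ^ (1 / 2 : ℝ))) * (G : ℝ) ^ (-((n + 3 : ℕ) : ℝ)) := by
        gcongr
    _ = 2 * (G : ℝ) ^ (-(3 / 2 : ℝ)) := by
        have hGp : (0 : ℝ) < G := by linarith
        rw [← Real.rpow_natCast (G : ℝ) (n + 1), mul_left_comm, mul_assoc, ← Real.rpow_add hGp,
          ← Real.rpow_add hGp]
        congr 2
        push_cast
        ring
    _ = _ := by rw [hGabs]

end OEis

namespace OEis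

theorem ratGcd_eq_one_iff {m : ℕ} {v : Fin m → ℚ} (hv : inLat v) :
    ratGcd v = 1 ↔ ∀ p : ℕ, (∀ i, ∃ x : ℤ, v i = p * x) → p = 1 := by
  choose x hx using hv
  have hgcd : ratGcd v = Finset.univ.gcd fun i => (x i).natAbs := by
    simp [ratGcd, hx]
  rw [hgcd]
  constructor
  · intro h p hp
    rw [← Nat.dvd_one, ← h]
    refine Finset.dvd_gcd fun i _ => ?_
    obtain ⟨y, hy⟩ := hp i
    rw [hx] at hy
    exact Int.natCast_dvd.mp ⟨y, by exact_mod_cast hy⟩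
  · intro h
    refine h _ fun i => ?_
    obtain ⟨y, hy⟩ := Int.natCast_dvd.mpr
      (Finset.gcd_dvd (f := fun i => (x i).natAbs) (Finset.mem_univ i))
    exact ⟨y, by rw [hx]; exact_mod_cast hy⟩

variable {n : ℕ} {S : Matrix (Fin n) (Fin n) ℤ}

theorem mulVec_intCast {m : ℕ} (A : Matrix (Fin m) (Fin m) ℤ) (v : Fin m → ℤ) (i : Fin m) :
    (A.map (Int.cast : ℤ → ℚ)).mulVec (fun j => (v j : ℚ)) i = ((A.mulVec v i : ℤ) : ℚ) := by
  simp [Matrix.mulVec, dotProduct]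

theorem exists_quadF_MatS0_intCast_eq (heven : ∀ v : Fin n → ℤ, 2 ∣ v ⬝ᵥ S.mulVec v)
    (m : Fin (n + 2) → ℤ) : ∃ q : ℤ, quadF ℚ (MatS0 n S) (fun i => (m i : ℚ)) = q := by
  obtain ⟨t, ht⟩ := heven (vmid m)
  refine ⟨vfirst m * vlast m - t, ?_⟩
  have h : bilin ℚ S (fun i => ((vmid m i : ℤ) : ℚ)) (fun i => ((vmid m i : ℤ) : ℚ)) = 2 * t := by
    have h1 : (((vmid m) ⬝ᵥ S.mulVec (vmid m) : ℤ) : ℚ) = ((2 * t : ℤ) : ℚ) := by rw [ht]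
    push_cast at h1
    rw [← h1, bilin]
    simp [Matrix.mulVec, dotProduct]
  have h2 : vmid (fun i => (m i : ℚ)) = fun i => ((vmid m i : ℤ) : ℚ) := rfl
  rw [quadF_MatS0, h2, quadF, h]
  push_cast
  rw [mul_div_cancel_left₀ _ two_ne_zero]
  rfl

/-- The map `(δ, d, γ) ↦ (δ - (d,m)₀ - γQ₀(m), -(d + γm), γ)`, which preserves `Q₁`. -/
def flipShift (S : Matrix (Fin n) (Fin n) ℤ) (m : Fin (n + 2) → ℤ) (g : Fin (n + 4) → ℚ) :
    Fin (n + 4) → ℚ :=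
  glue (vfirst g - bilin ℚ (MatS0 n S) (vmid g) (fun i => (m i : ℚ))
      - vlast g * quadF ℚ (MatS0 n S) (fun i => (m i : ℚ)))
    (-(vmid g + vlast g • fun i => (m i : ℚ))) (vlast g)

theorem vlast_flipShift (m : Fin (n + 2) → ℤ) (g : Fin (n + 4) → ℚ) :
    vlast (flipShift S m g) = vlast g := vlast_glue _ _ _

theorem vmid_flipShift (m : Fin (n + 2) → ℤ) (g : Fin (n + 4) → ℚ) :
    vmid (flipShift S m g) = -(vmid g + vlast g • fun i => (m i : ℚ)) := vmid_glue _ _ _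

theorem vfirst_flipShift (m : Fin (n + 2) → ℤ) (g : Fin (n + 4) → ℚ) :
    vfirst (flipShift S m g) = vfirst g - bilin ℚ (MatS0 n S) (vmid g) (fun i => (m i : ℚ))
      - vlast g * quadF ℚ (MatS0 n S) (fun i => (m i : ℚ)) := vfirst_glue _ _ _

theorem bilin_neg_left {K : Type} [Field K] {m : ℕ} (A : Matrix (Fin m) (Fin m) ℤ)
    (u v : Fin m → K) : bilin K A (-u) v = -bilin K A u v := by
  simp [bilin]

theorem quadF_neg {K : Type} [Field K] {m : ℕ} (A : Matrix (Fin m) (Fin m) ℤ)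
    (u : Fin m → K) : quadF K A (-u) = quadF K A u := by
  simp [quadF, bilin, Matrix.mulVec_neg]

theorem flipShift_flipShift (m : Fin (n + 2) → ℤ) (g : Fin (n + 4) → ℚ) :
    flipShift S m (flipShift S m g) = g := by
  refine ext_first_mid_last (m := n + 2) ?_ ?_ ?_
  · rw [vfirst_flipShift, vfirst_flipShift, vmid_flipShift, vlast_flipShift, bilin_neg_left,
      bilin_add_left, bilin_smul_left, bilin_self]
    ring
  · rw [vmid_flipShift, vmid_flipShift, vlast_flipShift]
    abel
  · rw [vlast_flipShift, vlast_flipShift]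

theorem quadF_flipShift (hsymm : S.IsSymm) (m : Fin (n + 2) → ℤ) (g : Fin (n + 4) → ℚ) :
    quadF ℚ (MatS1 n S) (flipShift S m g) = quadF ℚ (MatS1 n S) g := by
  rw [quadF_MatS1, quadF_MatS1, vfirst_flipShift, vlast_flipShift, vmid_flipShift, quadF_neg,
    quadF_add (isSymm_MatS0 hsymm), bilin_smul_right, quadF_smul]
  ring

theorem forall_mulVec_MatS1_iff (g : Fin (n + 4) → ℚ) (P : ℚ → Prop) :
    (∀ i, P (((MatS1 n S).map (Int.cast : ℤ → ℚ)).mulVec g i)) ↔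
      P (vlast g) ∧ (∀ i, P (((MatS0 n S).map (Int.cast : ℤ → ℚ)).mulVec (vmid g) i)) ∧
        P (vfirst g) := by
  have h := forall_iff_first_mid_last (m := n + 2)
    (p := fun i => P (((hyp (MatS0 n S)).map (Int.cast : ℤ → ℚ)).mulVec g i))
  simp only [hyp_mulVec_first, hyp_mulVec_mid, hyp_mulVec_last] at h
  exact h

theorem dvd_mulVec_flipShift (hsymm : S.IsSymm) (heven : ∀ v : Fin n → ℤ, 2 ∣ v ⬝ᵥ S.mulVec v)
    (m : Fin (n + 2) → ℤ) {g : Fin (n + 4) → ℚ} {p : ℕ}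
    (h : ∀ i, ∃ x : ℤ, ((MatS1 n S).map (Int.cast : ℤ → ℚ)).mulVec g i = p * x) :
    ∀ i, ∃ x : ℤ, ((MatS1 n S).map (Int.cast : ℤ → ℚ)).mulVec (flipShift S m g) i = p * x := by
  rw [forall_mulVec_MatS1_iff (P := fun v => ∃ x : ℤ, v = p * x)] at h ⊢
  obtain ⟨⟨x0, h0⟩, hm, x1, h1⟩ := h
  choose x hx using hm
  obtain ⟨q, hq⟩ := exists_quadF_MatS0_intCast_eq heven m
  rw [vlast_flipShift, vmid_flipShift, vfirst_flipShift]
  refine ⟨⟨x0, h0⟩, fun i => ⟨-(x i + x0 * (MatS0 n S).mulVec m i), ?_⟩,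
    x1 - ∑ i, m i * x i - x0 * q, ?_⟩
  · rw [Matrix.mulVec_neg, Matrix.mulVec_add, Matrix.mulVec_smul, Pi.neg_apply, Pi.add_apply,
      Pi.smul_apply, hx, mulVec_intCast, h0, smul_eq_mul]
    push_cast
    ring
  · rw [bilin_comm (isSymm_MatS0 hsymm), bilin, dotProduct, hq, h0, h1]
    simp_rw [hx]
    push_cast
    rw [mul_sub, mul_sub, Finset.mul_sum, mul_assoc]
    congr 2
    exact Finset.sum_congr rfl fun i _ => by ring

theorem inLat_mulVec_iff {A : Matrix (Fin n) (Fin n) ℤ} {v : Fin n → ℚ} :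
    inLat ((A.map (Int.cast : ℤ → ℚ)).mulVec v) ↔
      ∀ i, ∃ x : ℤ, (A.map (Int.cast : ℤ → ℚ)).mulVec v i = (1 : ℕ) * x := by
  simp [inLat]

theorem ratGcd_flipShift_eq_one (hsymm : S.IsSymm)
    (heven : ∀ v : Fin n → ℤ, 2 ∣ v ⬝ᵥ S.mulVec v) (m : Fin (n + 2) → ℤ) {g : Fin (n + 4) → ℚ}
    (hg : inDual (MatS1 n S) g)
    (h : ratGcd (((MatS1 n S).map (Int.cast : ℤ → ℚ)).mulVec g) = 1) :
    ratGcd (((MatS1 n S).map (Int.cast : ℤ → ℚ)).mulVec (flipShift S m g)) = 1 := by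
  have hT : inLat (((MatS1 n S).map (Int.cast : ℤ → ℚ)).mulVec (flipShift S m g)) :=
    inLat_mulVec_iff.mpr (dvd_mulVec_flipShift hsymm heven m (inLat_mulVec_iff.mp hg))
  rw [ratGcd_eq_one_iff hg] at h
  rw [ratGcd_eq_one_iff hT]
  intro p hp
  refine h p ?_
  have := dvd_mulVec_flipShift hsymm heven m hp
  rwa [flipShift_flipShift] at this

/-- `a` lies in the dual lattice of `S₁` and is integral in its outer hyperbolic coordinates. -/
def IsOuterIntegral (n : ℕ) (S : Matrix (Fin n) (Fin n) ℤ) (a : Fin (n + 4) → ℚ) : Prop :=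
  (∃ x : ℤ, vfirst a = x) ∧ (∃ x : ℤ, vlast a = x) ∧ inDual (MatS0 n S) (vmid a)

theorem IsOuterIntegral.neg {a : Fin (n + 4) → ℚ} (ha : IsOuterIntegral n S a) :
    IsOuterIntegral n S (fun i => -a i) := by
  obtain ⟨⟨x, hx⟩, ⟨y, hy⟩, h⟩ := ha
  refine ⟨⟨-x, ?_⟩, ⟨-y, ?_⟩, fun i => ?_⟩
  · rw [Int.cast_neg, ← hx]
    rfl
  · rw [Int.cast_neg, ← hy]
    rfl
  · obtain ⟨t, ht⟩ := h i
    refine ⟨-t, ?_⟩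
    rw [Int.cast_neg, ← ht]
    exact congrFun (Matrix.mulVec_neg (vmid a) _) i

theorem IsOuterIntegral.inLatShift {a g : Fin (n + 4) → ℚ} (ha : IsOuterIntegral n S a)
    (hg : inLatShift a g) : IsOuterIntegral n S g := by
  obtain ⟨⟨x, hx⟩, ⟨y, hy⟩, h⟩ := ha
  choose t ht using hg
  refine ⟨⟨vfirst t + x, ?_⟩, ⟨vlast t + y, ?_⟩, fun i => ?_⟩
  · have h1 := ht ⟨0, by omega⟩
    rw [vfirst] at hx
    rw [hx] at h1
    push_cast
    exact sub_eq_iff_eq_add.mp h1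
  · have h1 := ht ⟨n + 3, by omega⟩
    rw [vlast] at hy
    rw [hy] at h1
    push_cast
    exact sub_eq_iff_eq_add.mp h1
  · obtain ⟨u, hu⟩ := h i
    refine ⟨(MatS0 n S).mulVec (vmid t) i + u, ?_⟩
    have h1 : vmid g = (fun j => ((vmid t j : ℤ) : ℚ)) + vmid a :=
      funext fun j => sub_eq_iff_eq_add.mp (ht _)
    rw [h1, Matrix.mulVec_add, Pi.add_apply, mulVec_intCast, hu]
    push_cast
    rfl

theorem IsOuterIntegral.inDual_MatS1 {a : Fin (n + 4) → ℚ} (ha : IsOuterIntegral n S a) :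
    inDual (MatS1 n S) a :=
  (forall_mulVec_MatS1_iff a fun v => ∃ x : ℤ, v = x).mpr ⟨ha.2.1, ha.2.2, ha.1⟩

theorem IsStdCusp.isOuterIntegral {c : Fin (n + 4) → ℚ} (hc : IsStdCusp n S c) :
    IsOuterIntegral n S c := by
  refine ⟨⟨1, by rw [hc.vfirst_eq, Int.cast_one]⟩, hc.exists_vlast_eq, ?_⟩
  rw [inDual, MatS0, forall_iff_first_mid_last]
  simp only [hyp_mulVec_first, hyp_mulVec_mid, hyp_mulVec_last]
  refine ⟨⟨0, by rw [hc.vlast_vmid, Int.cast_zero]⟩, fun i => ?_,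
    ⟨0, by rw [hc.vfirst_vmid, Int.cast_zero]⟩⟩
  obtain ⟨x, hx⟩ := hc.inDual_vmid_vmid i
  refine ⟨-x, ?_⟩
  rw [Int.cast_neg, ← hx]
  simp [Matrix.mulVec, dotProduct]

theorem inLatShift_flipShift (hsymm : S.IsSymm)
    (heven : ∀ v : Fin n → ℤ, 2 ∣ v ⬝ᵥ S.mulVec v) (m : Fin (n + 2) → ℤ)
    {a g : Fin (n + 4) → ℚ} (ha : IsOuterIntegral n S a) (hg : inLatShift a g) :
    inLatShift (fun i => -a i) (flipShift S m g) := by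
  have hg' := ha.inLatShift hg
  have hT : inDual (MatS1 n S) (flipShift S m g) := inLat_mulVec_iff.mpr
    (dvd_mulVec_flipShift hsymm heven m (inLat_mulVec_iff.mp hg'.inDual_MatS1))
  obtain ⟨⟨x, hx⟩, ⟨y, hy⟩, -⟩ := ha
  obtain ⟨-, ⟨y', hy'⟩, -⟩ := hg'
  obtain ⟨⟨y'', hy''⟩, -, ⟨x'', hx''⟩⟩ :=
    (forall_mulVec_MatS1_iff _ fun v => ∃ x : ℤ, v = x).mp hT
  refine (forall_iff_first_mid_last (m := n + 2)).mpr ⟨⟨x'' + x, ?_⟩, fun i => ?_, ⟨y'' + y, ?_⟩⟩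
  · push_cast
    rw [← hx'', ← hx, sub_neg_eq_add]
    rfl
  · obtain ⟨t, ht⟩ := hg ⟨(i : ℕ) + 1, by have := i.isLt; omega⟩
    refine ⟨-(t + y' * m i), ?_⟩
    have h1 := congrFun (vmid_flipShift (S := S) m g) i
    rw [hy'] at h1
    simp only [Pi.neg_apply, Pi.add_apply, Pi.smul_apply, smul_eq_mul, vmid] at h1
    rw [h1]
    push_cast
    rw [← ht]
    ring
  · push_cast
    rw [← hy'', ← hy, sub_neg_eq_add]
    rfl

theorem jay_flipShift (hsymm : S.IsSymm) (m : Fin (n + 2) → ℤ) {g : Fin (n + 4) → ℚ}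
    (hg : quadF ℚ (MatS1 n S) g = 0) (hl : vlast g ≠ 0) (z : Fin (n + 2) → ℂ) :
    jay n S (flipShift S m g) z = -((vlast g : ℚ) : ℂ) *
      quadF ℂ (MatS0 n S) (fun i => z i + (((vmid g i / vlast g : ℚ) : ℝ) : ℂ) + m i) := by
  set γ : ℂ := ((vlast g : ℚ) : ℂ) with hγ
  have hγ0 : γ ≠ 0 := by rw [hγ]; exact_mod_cast hl
  set d : Fin (n + 2) → ℂ := fun i => ((vmid g i : ℚ) : ℂ) with hd
  set M : Fin (n + 2) → ℂ := fun i => (m i : ℂ) with hM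
  have hsym := isSymm_MatS0 (n := n) hsymm
  have hv : (fun i => z i + (((vmid g i / vlast g : ℚ) : ℝ) : ℂ) + m i) = z + γ⁻¹ • d + M := by
    ext i
    simp [hd, hM, hγ, div_eq_inv_mul]
  have hmid : (fun i => ((vmid (flipShift S m g) i : ℚ) : ℂ)) = -(d + γ • M) := by
    ext i
    rw [vmid_flipShift]
    simp [hd, hM, hγ]
  have hMcast : (fun i => (((m i : ℚ)) : ℂ)) = M := by
    ext i
    simp [hM]
  have hfirst : ((vfirst (flipShift S m g) : ℚ) : ℂ)
      = ((vfirst g : ℚ) : ℂ) - bilin ℂ (MatS0 n S) d M - γ * quadF ℂ (MatS0 n S) M := by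
    rw [vfirst_flipShift]
    push_cast
    have h1 := map_bilin (Rat.castHom ℂ) (MatS0 n S) (vmid g) (fun i => (m i : ℚ))
    have h2 := map_quadF (Rat.castHom ℂ) (MatS0 n S) (fun i => (m i : ℚ))
    simp only [eq_ratCast, hMcast] at h1 h2
    rw [h1, h2]
  have hQ : ((vfirst g : ℚ) : ℂ) * γ + quadF ℂ (MatS0 n S) d = 0 := by
    have h1 := map_quadF (Rat.castHom ℂ) (MatS0 n S) (vmid g)
    simp only [eq_ratCast] at h1
    rw [quadF_MatS1] at hg
    rw [hd, ← h1, hγ]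
    exact_mod_cast hg
  rw [jay, vlast_flipShift, hmid, hfirst, hv, quadF_add hsym, quadF_add hsym, quadF_smul,
    bilin_neg_left, bilin_add_left, bilin_add_left, bilin_smul_left, bilin_smul_left,
    bilin_smul_right, bilin_comm hsym z d, bilin_comm hsym z M]
  field_simp
  linear_combination hQ

end OEis

namespace OEis

variable {n : ℕ} {S : Matrix (Fin n) (Fin n) ℤ} {c : Fin (n + 4) → ℚ}

/-- The pairs `(γ, g)` over which the exponential sums in the Fourier coefficients run. -/
abbrev SigmaGset (n : ℕ) (S : Matrix (Fin n) (Fin n) ℤ) (c : Fin (n + 4) → ℚ) : Type :=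
  Σ γ : {γ : ℤ // γ ≠ 0}, Gset n S c γ.1

theorem vlast_ne_zero_of_mem_Gset {γ : ℤ} (hγ : γ ≠ 0) {g : Fin (n + 4) → ℚ}
    (hg : g ∈ Gset n S c γ) : vlast g ≠ 0 := by
  rw [hg.2.2.2.1]
  exact_mod_cast hγ

section

variable (hsymm : S.IsSymm) (heven : ∀ v : Fin n → ℤ, 2 ∣ v ⬝ᵥ S.mulVec v)
  (hc : IsStdCusp n S c)
include hsymm heven hc

theorem flipShift_mem {γ : ℤ} (hγ : γ ≠ 0) {g : Fin (n + 4) → ℚ} (hg : g ∈ Gset n S c γ)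
    (m : Fin (n + 2) → ℤ) :
    flipShift S m g ∈ cuspSet n S c ∧ vlast (flipShift S m g) ≠ 0 := by
  have hneg := hc.isOuterIntegral.neg
  refine ⟨⟨?_, ?_, ?_⟩, ?_⟩
  · simpa using inLatShift_flipShift hsymm heven m hneg hg.1
  · rw [quadF_flipShift hsymm, hg.2.1]
  · exact ratGcd_flipShift_eq_one hsymm heven m (hneg.inLatShift hg.1).inDual_MatS1 hg.2.2.1
  · rw [vlast_flipShift]
    exact vlast_ne_zero_of_mem_Gset hγ hg

/-- The decomposition of the index set of the Eisenstein series into orbits under translation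
of the middle component. -/
def cuspMap (p : SigmaGset n S c × (Fin (n + 2) → ℤ)) :
    {g : Fin (n + 4) → ℚ // g ∈ cuspSet n S c ∧ vlast g ≠ 0} :=
  ⟨flipShift S p.2 p.1.2.1, flipShift_mem hsymm heven hc p.1.1.2 p.1.2.2 p.2⟩

theorem cuspMap_injective : Function.Injective (cuspMap hsymm heven hc) := by
  rintro ⟨⟨⟨γ, hγ⟩, g, hg⟩, m⟩ ⟨⟨⟨γ', hγ'⟩, g', hg'⟩, m'⟩ h
  have h1 : flipShift S m g = flipShift S m' g' := congrArg Subtype.val h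
  have hl := congrArg vlast h1
  rw [vlast_flipShift, vlast_flipShift, hg.2.2.2.1, hg'.2.2.2.1] at hl
  obtain rfl : γ = γ' := by exact_mod_cast hl
  have hm : m = m' := by
    ext i
    have h2 := congrFun (congrArg vmid h1) i
    simp only [vmid_flipShift, hg.2.2.2.1, hg'.2.2.2.1, Pi.neg_apply, Pi.add_apply,
      Pi.smul_apply, smul_eq_mul] at h2
    have h3 : ((midNum c g i + γ * m i : ℤ) : ℚ) = (midNum c g' i + γ * m' i : ℤ) := by
      push_cast
      rw [midNum_cast hg, midNum_cast hg']
      linarith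
    have h4 : midNum c g i + γ * m i = midNum c g' i + γ * m' i := by exact_mod_cast h3
    have h5 := Finset.mem_Ico.mp (midNum_mem hg i)
    have h6 := Finset.mem_Ico.mp (midNum_mem hg' i)
    rw [Int.natCast_natAbs] at h5 h6
    have h7 : |γ * (m i - m' i)| < |γ| := by
      rw [abs_lt]
      constructor <;> nlinarith
    rw [abs_mul] at h7
    have h8 : |m i - m' i| < 1 := by
      by_contra! h
      nlinarith [abs_nonneg γ]
    exact sub_eq_zero.mp (Int.abs_lt_one_iff.mp h8)
  subst hm
  obtain rfl : g = g' := by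
    rw [← flipShift_flipShift (S := S) m g, h1, flipShift_flipShift]
  rfl

theorem cuspMap_surjective : Function.Surjective (cuspMap hsymm heven hc) := by
  rintro ⟨h, ⟨hlat, hQ, hgcd⟩, hl⟩
  have hout := hc.isOuterIntegral
  obtain ⟨-, ⟨γ, hγ⟩, -⟩ := hout.inLatShift hlat
  have hγ0 : γ ≠ 0 := by
    rintro rfl
    exact hl (by rw [hγ, Int.cast_zero])
  have hlat' := hlat
  choose t ht using hlat'
  set m : Fin (n + 2) → ℤ := fun i => (-vmid t i) / γ with hm
  have hg : flipShift S m h ∈ Gset n S c γ := by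
    refine ⟨inLatShift_flipShift hsymm heven m hout fun i => ⟨t i, ht i⟩, ?_, ?_, ?_, fun i => ?_⟩
    · rw [quadF_flipShift hsymm, hQ]
    · exact ratGcd_flipShift_eq_one hsymm heven m
        (hout.inLatShift fun i => ⟨t i, ht i⟩).inDual_MatS1 hgcd
    · rw [vlast_flipShift, hγ]
    · have h1 : vmid h i = (vmid t i : ℤ) + vmid c i := sub_eq_iff_eq_add.mp (ht _)
      have h2 : vmid (flipShift S m h) i + vmid c i = ((-vmid t i) % γ : ℤ) := by
        rw [vmid_flipShift, hγ, Int.emod_def]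
        simp only [Pi.neg_apply, Pi.add_apply, Pi.smul_apply, smul_eq_mul, h1, hm]
        push_cast
        ring
      rw [h2]
      exact ⟨by exact_mod_cast Int.emod_nonneg _ hγ0, by exact_mod_cast Int.emod_lt_abs _ hγ0⟩
  exact ⟨⟨⟨⟨γ, hγ0⟩, _, hg⟩, m⟩, Subtype.ext (flipShift_flipShift m h)⟩

/-- The bijection underlying the unfolding of the Eisenstein series. -/
noncomputable def cuspEquiv : SigmaGset n S c × (Fin (n + 2) → ℤ) ≃
    {g : Fin (n + 4) → ℚ // g ∈ cuspSet n S c ∧ vlast g ≠ 0} :=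
  Equiv.ofBijective (cuspMap hsymm heven hc)
    ⟨cuspMap_injective hsymm heven hc, cuspMap_surjective hsymm heven hc⟩

end

/-- The translation vector `d/γ`. -/
def slope (g : Fin (n + 4) → ℚ) (i : Fin (n + 2)) : ℝ := ((vmid g i / vlast g : ℚ) : ℝ)

theorem norm_slope_le {γ : ℤ} (hγ : γ ≠ 0) {g : Fin (n + 4) → ℚ} (hg : g ∈ Gset n S c γ) :
    ‖slope g‖ ≤ 1 + ‖fun i => ((vmid c i : ℚ) : ℝ)‖ := by
  refine (pi_norm_le_iff_of_nonneg (by positivity)).mpr fun i => ?_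
  have hγ1 : (1 : ℝ) ≤ |(γ : ℝ)| := by exact_mod_cast Int.one_le_abs hγ
  obtain ⟨h1, h2⟩ := hg.2.2.2.2 i
  have h1' : (0 : ℝ) ≤ (vmid g i : ℚ) + (vmid c i : ℚ) := by exact_mod_cast h1
  have h2' : ((vmid g i : ℚ) : ℝ) + (vmid c i : ℚ) < |(γ : ℝ)| := by exact_mod_cast h2
  have h3 := norm_le_pi_norm (fun i => ((vmid c i : ℚ) : ℝ)) i
  rw [Real.norm_eq_abs] at h3
  set B := ‖fun i => ((vmid c i : ℚ) : ℝ)‖ with hB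
  have hB0 : 0 ≤ B := norm_nonneg _
  rw [slope, hg.2.2.2.1, Rat.cast_div, Rat.cast_intCast, Real.norm_eq_abs, abs_div,
    div_le_iff₀ (by linarith)]
  obtain ⟨h4, h5⟩ := abs_le.mp h3
  have h6 : B ≤ B * |(γ : ℝ)| := le_mul_of_one_le_right hB0 hγ1
  rw [abs_le]
  constructor <;> nlinarith

theorem even_neg_zpow {k : ℕ} (hke : Even k) (x : ℂ) : (-x) ^ (-(k : ℤ)) = x ^ (-(k : ℤ)) :=
  Even.neg_zpow (by simpa using hke) x

variable (hsymm : S.IsSymm) (hpos : ∀ v : Fin n → ℝ, v ≠ 0 → 0 < bilin ℝ S v v)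
  (heven : ∀ v : Fin n → ℤ, 2 ∣ v ⬝ᵥ S.mulVec v) (hc : IsStdCusp n S c)
  {k : ℕ} (hk : n + 2 < k) (hke : Even k) {z : Fin (n + 2) → ℂ} (hz : z ∈ HS n S)

include hsymm heven hc hke in
theorem jay_cuspEquiv_zpow (z : Fin (n + 2) → ℂ)
    (x : SigmaGset n S c) (m : Fin (n + 2) → ℤ) :
    jay n S (cuspEquiv hsymm heven hc (x, m)).1 z ^ (-(k : ℤ)) = (x.1.1 : ℂ) ^ (-(k : ℤ)) *
      quadF ℂ (MatS0 n S) (fun i => z i + slope x.2.1 i + m i) ^ (-(k : ℤ)) := by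
  have h := jay_flipShift hsymm m x.2.2.2.1 (vlast_ne_zero_of_mem_Gset x.1.2 x.2.2) z
  rw [x.2.2.2.2.2.1, Rat.cast_intCast] at h
  change jay n S (flipShift S m x.2.1) z ^ (-(k : ℤ)) = _
  rw [h, mul_zpow, even_neg_zpow hke]
  simp only [slope, x.2.2.2.2.2.1]

include hsymm hpos heven hc hk hke hz

theorem summable_norm_jay_cuspEquiv :
    Summable fun p : SigmaGset n S c × (Fin (n + 2) → ℤ) =>
      ‖jay n S (cuspEquiv hsymm heven hc p).1 z ^ (-(k : ℤ))‖ := by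
  obtain ⟨C, hC, hb⟩ := exists_norm_quadF_zpow_le hsymm hpos hz k
  set R : ℝ := 1 + ‖fun i => ((vmid c i : ℚ) : ℝ)‖ with hR
  have hs := Summable.mul_of_nonneg (summable_sigma_Gset hc hk)
    ((summable_inv_one_add_norm_pow (ι := Fin (n + 2)) (by simpa using hk)).mul_left
      (C * (1 + R) ^ k)) (fun _ => norm_nonneg _) (fun m => by positivity)
  refine Summable.of_nonneg_of_le (fun _ => norm_nonneg _) (fun p => ?_) hs
  obtain ⟨x, m⟩ := p
  rw [jay_cuspEquiv_zpow hsymm heven hc hke, norm_mul]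
  refine mul_le_mul_of_nonneg_left ?_ (norm_nonneg _)
  have h1 := hb (slope x.2.1 + fun i => (m i : ℝ))
  have h2 := inv_one_add_norm_pow_add_le (norm_slope_le x.1.2 x.2.2) (fun i => (m i : ℝ)) k
  have h3 : (fun i => z i + slope x.2.1 i + m i)
      = fun i => z i + ((slope x.2.1 + fun i => (m i : ℝ)) i : ℝ) := by
    ext i
    simp [add_assoc]
  rw [h3, mul_assoc]
  exact h1.trans (mul_le_mul_of_nonneg_left h2 hC)

omit hsymm hpos heven hke hz in
theorem summable_norm_exp_Gset (lam : Fin (n + 2) → ℚ) :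
    Summable fun x : SigmaGset n S c => ‖((x.1.1 : ℂ)) ^ (-(k : ℤ)) *
      Complex.exp (2 * Real.pi * Complex.I *
        ((bilin ℚ (MatS0 n S) lam (vmid x.2.1) / (x.1.1 : ℚ) : ℚ) : ℂ))‖ := by
  refine (summable_sigma_Gset hc hk).congr fun x => ?_
  rw [norm_mul, norm_exp_two_pi_I_mul, ← Complex.ofReal_ratCast, Complex.ofReal_im]
  simp

/-- The double sum over denominators and representatives in the Fourier coefficients. -/
noncomputable def expSum (n : ℕ) (S : Matrix (Fin n) (Fin n) ℤ) (k : ℕ) (c : Fin (n + 4) → ℚ)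
    (lam : Fin (n + 2) → ℚ) : ℂ :=
  ∑' x : SigmaGset n S c, ((x.1.1 : ℂ)) ^ (-(k : ℤ)) *
    Complex.exp (2 * Real.pi * Complex.I *
      ((bilin ℚ (MatS0 n S) lam (vmid x.2.1) / (x.1.1 : ℚ) : ℚ) : ℂ))

omit hsymm hpos heven hke hz in
theorem aFC_mul_exp_eq (z : Fin (n + 2) → ℂ) (lam : DualCone n S) :
    aFC n S k c lam.1 * Complex.exp (2 * Real.pi * Complex.I *
        bilin ℂ (MatS0 n S) (fun i => ((lam.1 i : ℚ) : ℂ)) z)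
      = ((ckS n S k : ℝ) : ℂ) / 2 * (coneFun n S ((k : ℝ) - (n + 2) / 2) z
          (fun i => ((lam.1 i : ℚ) : ℝ)) * expSum n S k c lam.1) := by
  have h1 : expSum n S k c lam.1 = ∑' γ : {γ : ℤ // γ ≠ 0}, ((γ.1 : ℂ)) ^ (-(k : ℤ)) *
      ∑' g : Gset n S c γ.1,
        Complex.exp (2 * Real.pi * Complex.I *
          ((bilin ℚ (MatS0 n S) lam.1 (vmid g.1) / (γ.1 : ℚ) : ℚ) : ℂ)) := by
    rw [expSum, (summable_norm_exp_Gset hc hk lam.1).of_norm.tsum_sigma]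
    simp only [tsum_mul_left]
  have h2 : ((quadF ℚ (MatS0 n S) lam.1 : ℚ) : ℝ)
      = quadF ℝ (MatS0 n S) (fun i => ((lam.1 i : ℚ) : ℝ)) := by
    simpa using map_quadF (Rat.castHom ℝ) (MatS0 n S) lam.1
  rw [aFC, ← h1, h2, coneFun, Set.indicator_of_mem lam.2.2]
  simp only [Complex.ofReal_ratCast]
  ring

omit heven hke in
theorem summable_norm_mul_coneFun :
    Summable fun p : SigmaGset n S c × DualCone n S =>
      ‖(p.1.1.1 : ℂ) ^ (-(k : ℤ)) * Complex.exp (2 * Real.pi * Complex.I *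
        ((bilin ℚ (MatS0 n S) p.2.1 (vmid p.1.2.1) / (p.1.1.1 : ℚ) : ℚ) : ℂ)) *
        coneFun n S ((k : ℝ) - (n + 2) / 2) z (fun i => ((p.2.1 i : ℚ) : ℝ))‖ := by
  have ha : (0 : ℝ) ≤ (k : ℝ) - (n + 2) / 2 := by
    have hkr : (n : ℝ) + 2 < k := by exact_mod_cast hk
    have hn0 : (0 : ℝ) ≤ n := n.cast_nonneg
    linarith
  refine (Summable.mul_of_nonneg (summable_sigma_Gset hc hk)
    (summable_norm_coneFun hsymm hpos ha hz) (fun _ => norm_nonneg _)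
    (fun _ => norm_nonneg _)).congr fun p => ?_
  rw [norm_mul, norm_mul, norm_exp_two_pi_I_mul, ← Complex.ofReal_ratCast, Complex.ofReal_im]
  simp

omit heven hke in
theorem summable_norm_aFC_mul_exp :
    Summable fun lam : DualCone n S => ‖aFC n S k c lam.1 *
      Complex.exp (2 * Real.pi * Complex.I *
        bilin ℂ (MatS0 n S) (fun i => ((lam.1 i : ℚ) : ℂ)) z)‖ := by
  have h := (summable_norm_mul_coneFun hsymm hpos hc hk hz).prod_symm
  simp_rw [aFC_mul_exp_eq hc hk, norm_mul _ (coneFun n S _ _ _ * _)]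
  refine Summable.mul_left _ (Summable.of_nonneg_of_le (fun _ => norm_nonneg _) (fun lam => ?_)
    h.prod)
  rw [expSum, ← tsum_mul_left]
  refine (norm_tsum_le_tsum_norm ?_).trans (le_of_eq (tsum_congr fun x => ?_))
  · refine (h.prod_factor lam).congr fun x => ?_
    rw [mul_comm]
    rfl
  · rw [mul_comm]
    rfl

theorem tsum_jay_cuspEquiv (x : SigmaGset n S c) :
    ∑' m : Fin (n + 2) → ℤ, jay n S (cuspEquiv hsymm heven hc (x, m)).1 z ^ (-(k : ℤ))
      = (ckS n S k : ℂ) * ∑' lam : DualCone n S,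
        (x.1.1 : ℂ) ^ (-(k : ℤ)) * Complex.exp (2 * Real.pi * Complex.I *
          ((bilin ℚ (MatS0 n S) lam.1 (vmid x.2.1) / (x.1.1 : ℚ) : ℚ) : ℂ)) *
          coneFun n S ((k : ℝ) - (n + 2) / 2) z (fun i => ((lam.1 i : ℚ) : ℝ)) := by
  have hterm (lam : DualCone n S) :
      (x.1.1 : ℂ) ^ (-(k : ℤ)) * Complex.exp (2 * Real.pi * Complex.I *
          ((bilin ℚ (MatS0 n S) lam.1 (vmid x.2.1) / (x.1.1 : ℚ) : ℚ) : ℂ)) *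
          coneFun n S ((k : ℝ) - (n + 2) / 2) z (fun i => ((lam.1 i : ℚ) : ℝ))
        = (x.1.1 : ℂ) ^ (-(k : ℤ)) * coneFun n S ((k : ℝ) - (n + 2) / 2)
          (fun i => z i + slope x.2.1 i) (fun i => ((lam.1 i : ℚ) : ℝ)) := by
    rw [coneFun_add, ← mul_assoc]
    congr 4
    have h1 := map_bilin (Rat.castHom ℂ) (MatS0 n S) lam.1 ((x.1.1 : ℚ)⁻¹ • vmid x.2.1)
    rw [bilin_smul_right, inv_mul_eq_div] at h1
    simp only [eq_ratCast] at h1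
    rw [h1]
    congr 1
    ext i
    rw [slope, x.2.2.2.2.2.1, Complex.ofReal_ratCast, Pi.smul_apply, smul_eq_mul,
      inv_mul_eq_div]
  simp_rw [jay_cuspEquiv_zpow hsymm heven hc hke]
  rw [tsum_congr hterm, tsum_mul_left, tsum_quadF_zpow_eq hsymm hpos hk hke (add_ofReal_mem_HS hz (slope x.2.1)),
    mul_left_comm, tsum_mul_left]

theorem tsum_jay_eq_tsum_aFC :
    (1 / 2 : ℂ) * ∑' g : {g : Fin (n + 4) → ℚ // g ∈ cuspSet n S c ∧ vlast g ≠ 0},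
        (jay n S g.1 z) ^ (-(k : ℤ))
      = ∑' lam : DualCone n S, aFC n S k c lam.1 *
          Complex.exp (2 * Real.pi * Complex.I *
            bilin ℂ (MatS0 n S) (fun i => ((lam.1 i : ℚ) : ℂ)) z) := by
  have hsum := (summable_norm_mul_coneFun hsymm hpos hc hk hz).of_norm
  have hjay := (summable_norm_jay_cuspEquiv hsymm hpos heven hc hk hke hz).of_norm
  have hleft : ∑' g : {g : Fin (n + 4) → ℚ // g ∈ cuspSet n S c ∧ vlast g ≠ 0},
      (jay n S g.1 z) ^ (-(k : ℤ)) = ∑' x : SigmaGset n S c, ∑' m : Fin (n + 2) → ℤ,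
        jay n S (cuspEquiv hsymm heven hc (x, m)).1 z ^ (-(k : ℤ)) :=
    ((cuspEquiv hsymm heven hc).tsum_eq fun g => (jay n S g.1 z) ^ (-(k : ℤ))).symm.trans
      hjay.tsum_prod
  have hswap : ∑' x : SigmaGset n S c, ∑' lam : DualCone n S,
        (x.1.1 : ℂ) ^ (-(k : ℤ)) * Complex.exp (2 * Real.pi * Complex.I *
          ((bilin ℚ (MatS0 n S) lam.1 (vmid x.2.1) / (x.1.1 : ℚ) : ℚ) : ℂ)) *
          coneFun n S ((k : ℝ) - (n + 2) / 2) z (fun i => ((lam.1 i : ℚ) : ℝ))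
      = ∑' lam : DualCone n S, coneFun n S ((k : ℝ) - (n + 2) / 2) z
          (fun i => ((lam.1 i : ℚ) : ℝ)) * expSum n S k c lam.1 := by
    refine (Summable.tsum_comm (f := fun (x : SigmaGset n S c) (lam : DualCone n S) =>
      (x.1.1 : ℂ) ^ (-(k : ℤ)) * Complex.exp (2 * Real.pi * Complex.I *
        ((bilin ℚ (MatS0 n S) lam.1 (vmid x.2.1) / (x.1.1 : ℚ) : ℚ) : ℂ)) *
        coneFun n S ((k : ℝ) - (n + 2) / 2) z (fun i => ((lam.1 i : ℚ) : ℝ))) hsum).symm.trans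
      (tsum_congr fun lam => ?_)
    rw [tsum_mul_right, mul_comm, expSum]
  rw [hleft, tsum_congr (tsum_jay_cuspEquiv hsymm hpos heven hc hk hke hz), tsum_mul_left, hswap,
    tsum_congr (aFC_mul_exp_eq hc hk z), tsum_mul_left, ← mul_assoc, one_div_mul_eq_div]

end OEis

/-- Fourier expansion of the cusp term of `E_{k,S,c}`. -/
theorem eisenstein_cusp_term_fourier
    (n : ℕ) (hn : 1 ≤ n) (S : Matrix (Fin n) (Fin n) ℤ)
    (hsymm : S.IsSymm)
    (hpos : ∀ v : Fin n → ℝ, v ≠ 0 → 0 < bilin ℝ S v v)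
    (heven : ∀ v : Fin n → ℤ, 2 ∣ v ⬝ᵥ S.mulVec v)
    (k : ℕ) (hk : n + 2 < k) (hke : Even k)
    (c : Fin (n + 4) → ℚ) (hc : IsStdCusp n S c)
    (z : Fin (n + 2) → ℂ) (hz : z ∈ HS n S) :
    Summable (fun g : {g : Fin (n + 4) → ℚ // g ∈ cuspSet n S c ∧ vlast g ≠ 0} =>
      ‖(jay n S g.1 z) ^ (-(k : ℤ))‖) ∧
    (∀ lam : Fin (n + 2) → ℚ,
      Summable (fun x : Σ γ : {γ : ℤ // γ ≠ 0}, Gset n S c γ.1 =>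
        ‖((x.1.1 : ℂ)) ^ (-(k : ℤ)) *
          Complex.exp (2 * Real.pi * Complex.I *
            ((bilin ℚ (MatS0 n S) lam (vmid x.2.1) / (x.1.1 : ℚ) : ℚ) : ℂ))‖)) ∧
    Summable (fun lam : {lam : Fin (n + 2) → ℚ //
        inDual (MatS0 n S) lam ∧ (fun i => ((lam i : ℚ) : ℝ)) ∈ PosCone n S} =>
      ‖aFC n S k c lam.1 *
        Complex.exp (2 * Real.pi * Complex.I *
          bilin ℂ (MatS0 n S) (fun i => ((lam.1 i : ℚ) : ℂ)) z)‖) ∧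
    (1 / 2 : ℂ) *
      ∑' g : {g : Fin (n + 4) → ℚ // g ∈ cuspSet n S c ∧ vlast g ≠ 0},
        (jay n S g.1 z) ^ (-(k : ℤ))
    = ∑' lam : {lam : Fin (n + 2) → ℚ //
          inDual (MatS0 n S) lam ∧ (fun i => ((lam i : ℚ) : ℝ)) ∈ PosCone n S},
        aFC n S k c lam.1 *
          Complex.exp (2 * Real.pi * Complex.I *
            bilin ℂ (MatS0 n S) (fun i => ((lam.1 i : ℚ) : ℂ)) z) := by
  exact ⟨((cuspEquiv hsymm heven hc).summable_iff
      (f := fun g : {g : Fin (n + 4) → ℚ // g ∈ cuspSet n S c ∧ vlast g ≠ 0} =>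
        ‖(jay n S g.1 z) ^ (-(k : ℤ))‖)).mp
      (summable_norm_jay_cuspEquiv hsymm hpos heven hc hk hke hz),
    summable_norm_exp_Gset hc hk, summable_norm_aFC_mul_exp hsymm hpos hc hk hz,
    tsum_jay_eq_tsum_aFC hsymm hpos heven hc hk hke hz⟩
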